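/- arXiv:2605.06328 — 5 statements merged into one kernel-verified Lean document; each statement's English description precedes it below -/
import Mathlib

section
/- For any penalty parameter λ ≥ 2L_{f,1}/μ, the optimal penalty function 𝓛*_λ is L_{*,1}-smooth; that is, ‖∇𝓛*_λ(x) − ∇𝓛*_λ(x')‖ ≤ L_{*,1}‖x − x'‖ for all x, x' ∈ ℝ^{d_x}, where L_{*,1} = (L_{f,1} + 4L_{f,1}L_{g,1}/μ + L_{f,0}L_{g,2}/μ + L_{f,0}L_{g,1}L_{g,2}/μ² + L_{g,1}) · (1/μ + 2L_{g,1}/μ²) · (L_{f,1} + L_{f,0}L_{g,2}/μ). -/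
open scoped BigOperators RealInnerProductSpace

set_option linter.unusedVariables false

noncomputable section

abbrev Euc (d : ℕ) := EuclideanSpace ℝ (Fin d)

noncomputable def gradX {dx dy : ℕ} (f : Euc dx × Euc dy → ℝ) (x : Euc dx) (y : Euc dy) :
    Euc dx :=
  gradient (fun x' => f (x', y)) x

noncomputable def gradY {dx dy : ℕ} (f : Euc dx × Euc dy → ℝ) (x : Euc dx) (y : Euc dy) :
    Euc dy :=
  gradient (fun y' => f (x, y')) y

noncomputable def consD {n : ℕ} {V : Type*} [NormedAddCommGroup V] [NormedSpace ℝ V]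
    (w : Fin n → ℝ) (v : Fin n → V) : ℝ :=
  ∑ i, w i * ‖v i - ∑ j, w j • v j‖ ^ 2

noncomputable def trackS {n : ℕ} {V : Type*} [NormedAddCommGroup V] [NormedSpace ℝ V]
    (w : Fin n → ℝ) (t : Fin n → V) : ℝ :=
  ∑ j, w j * ‖(w j)⁻¹ • t j - ∑ l, t l‖ ^ 2

section PartialMinimization

set_option maxSynthPendingDepth 3

variable {X Y E : Type*} [NormedAddCommGroup X] [NormedSpace ℝ X]
  [NormedAddCommGroup Y] [InnerProductSpace ℝ Y] [NormedAddCommGroup E] [NormedSpace ℝ E]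

/-- The Hessian of `f` averaged over the segment from `p` to `q`. -/
def meanHessian (f : E → ℝ) (p q : E) : E →L[ℝ] E →L[ℝ] ℝ :=
  ∫ t in (0 : ℝ)..1, fderiv ℝ (fderiv ℝ f) (p + t • (q - p))

lemma hasFDerivAt_fderiv {f : E → ℝ} (hf : ContDiff ℝ 2 f) (p : E) :
    HasFDerivAt (fderiv ℝ f) (fderiv ℝ (fderiv ℝ f) p) p :=
  ((hf.fderiv_right (m := 1) (by norm_num)).differentiable (by norm_num) p).hasFDerivAt

lemma continuous_hessian_segment {f : E → ℝ} (hf : ContDiff ℝ 2 f) (p q : E) :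
    Continuous fun t : ℝ => fderiv ℝ (fderiv ℝ f) (p + t • (q - p)) := by
  have h : Continuous (fderiv ℝ (fderiv ℝ f)) :=
    (hf.fderiv_right (m := 1) (by norm_num)).continuous_fderiv (by norm_num)
  exact h.comp (by fun_prop)

lemma intervalIntegrable_hessian_segment {f : E → ℝ} (hf : ContDiff ℝ 2 f) (p q : E) :
    IntervalIntegrable (fun t : ℝ => fderiv ℝ (fderiv ℝ f) (p + t • (q - p)))
      MeasureTheory.volume 0 1 :=
  (continuous_hessian_segment hf p q).intervalIntegrable _ _

lemma meanHessian_apply {f : E → ℝ} (hf : ContDiff ℝ 2 f) (p q v w : E) :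
    meanHessian f p q v w =
      ∫ t in (0 : ℝ)..1, fderiv ℝ (fderiv ℝ f) (p + t • (q - p)) v w := by
  have hint := intervalIntegrable_hessian_segment hf p q
  rw [meanHessian, ContinuousLinearMap.intervalIntegral_apply hint,
    ContinuousLinearMap.intervalIntegral_apply]
  exact ((continuous_hessian_segment hf p q).clm_apply continuous_const).intervalIntegrable _ _

lemma meanHessian_apply_sub {f : E → ℝ} (hf : ContDiff ℝ 2 f) (p q : E) :
    meanHessian f p q (q - p) = fderiv ℝ f q - fderiv ℝ f p := by
  rw [meanHessian,
    ContinuousLinearMap.intervalIntegral_apply (intervalIntegrable_hessian_segment hf p q)]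
  have hd (t : ℝ) : HasDerivAt (fun t : ℝ => fderiv ℝ f (p + t • (q - p)))
      (fderiv ℝ (fderiv ℝ f) (p + t • (q - p)) (q - p)) t := by
    have hline : HasDerivAt (fun t : ℝ => p + t • (q - p)) (q - p) t := by
      simpa using ((hasDerivAt_id t).smul_const (q - p)).const_add p
    exact (hasFDerivAt_fderiv hf _).comp_hasDerivAt t hline
  rw [intervalIntegral.integral_eq_sub_of_hasDerivAt (fun t _ => hd t)]
  · simp
  · exact ((continuous_hessian_segment hf p q).clm_apply continuous_const).intervalIntegrable _ _

lemma meanHessian_comm {f : E → ℝ} (hf : ContDiff ℝ 2 f) (p q v w : E) :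
    meanHessian f p q v w = meanHessian f p q w v := by
  rw [meanHessian_apply hf, meanHessian_apply hf]
  congr 1
  ext t
  exact (hf.contDiffAt.isSymmSndFDerivAt (by simp)) v w

lemma norm_meanHessian_le {f : E → ℝ} {L : ℝ} (hL : ∀ p, ‖fderiv ℝ (fderiv ℝ f) p‖ ≤ L)
    (p q : E) : ‖meanHessian f p q‖ ≤ L := by
  simpa [meanHessian] using
    intervalIntegral.norm_integral_le_of_norm_le_const (a := (0 : ℝ)) (b := 1)
    (f := fun t : ℝ => fderiv ℝ (fderiv ℝ f) (p + t • (q - p))) fun t _ => hL _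

lemma le_meanHessian_apply_self {f : E → ℝ} (hf : ContDiff ℝ 2 f) {v : E} {c : ℝ}
    (hc : ∀ p, c ≤ fderiv ℝ (fderiv ℝ f) p v v) (p q : E) : c ≤ meanHessian f p q v v := by
  rw [meanHessian_apply hf]
  have h := intervalIntegral.integral_mono_on (μ := MeasureTheory.volume) (a := (0 : ℝ)) (b := 1)
    (f := fun _ => c) (g := fun t => fderiv ℝ (fderiv ℝ f) (p + t • (q - p)) v v)
    zero_le_one (by simp)
    ((((continuous_hessian_segment hf p q).clm_apply continuous_const).clm_apply
      continuous_const).intervalIntegrable _ _) fun t _ => hc _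
  simpa using h

lemma norm_meanHessian_sub_le {f : E → ℝ} (hf : ContDiff ℝ 2 f) {L δ : ℝ} (hL0 : 0 ≤ L)
    (hL : ∀ p q, ‖fderiv ℝ (fderiv ℝ f) p - fderiv ℝ (fderiv ℝ f) q‖ ≤ L * ‖p - q‖)
    {p p' q q' : E} (h : ‖p - q‖ ≤ δ) (h' : ‖p' - q'‖ ≤ δ) :
    ‖meanHessian f p p' - meanHessian f q q'‖ ≤ L * δ := by
  rw [meanHessian, meanHessian, ← intervalIntegral.integral_sub
    (intervalIntegrable_hessian_segment hf p p') (intervalIntegrable_hessian_segment hf q q')]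
  have hbound : ∀ t ∈ Set.uIoc (0 : ℝ) 1,
      ‖fderiv ℝ (fderiv ℝ f) (p + t • (p' - p)) - fderiv ℝ (fderiv ℝ f) (q + t • (q' - q))‖
        ≤ L * δ := by
    intro t ht
    rw [Set.uIoc_of_le zero_le_one] at ht
    refine (hL _ _).trans (mul_le_mul_of_nonneg_left ?_ hL0)
    have heq : p + t • (p' - p) - (q + t • (q' - q)) = (1 - t) • (p - q) + t • (p' - q') := by
      module
    have h1 : 0 ≤ 1 - t := by linarith [ht.2]
    rw [heq]
    refine (norm_add_le _ _).trans ?_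
    rw [norm_smul, norm_smul, Real.norm_of_nonneg h1, Real.norm_of_nonneg ht.1.le]
    nlinarith [mul_le_mul_of_nonneg_left h h1, mul_le_mul_of_nonneg_left h' ht.1.le]
  simpa using intervalIntegral.norm_integral_le_of_norm_le_const hbound

lemma norm_fderiv_fderiv_le {f : E → ℝ} {L : ℝ} (hL0 : 0 ≤ L)
    (hL : ∀ p q, ‖fderiv ℝ f p - fderiv ℝ f q‖ ≤ L * ‖p - q‖) (p : E) :
    ‖fderiv ℝ (fderiv ℝ f) p‖ ≤ L := by
  lift L to NNReal using hL0
  exact norm_fderiv_le_of_lipschitz ℝ (LipschitzWith.of_dist_le_mul fun p q => by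
    simpa [dist_eq_norm] using hL p q)

lemma le_hessian_of_strongConvexOn {g : X × Y → ℝ} (hg : ContDiff ℝ 2 g) {μ : ℝ}
    (hsc : ∀ x, StrongConvexOn Set.univ μ fun y => g (x, y)) (p : X × Y) (v : Y) :
    μ * ‖v‖ ^ 2 ≤ fderiv ℝ (fderiv ℝ g) p (0, v) (0, v) := by
  have hconv := (strongConvexOn_iff_convex.1 (hsc p.1)).comp_affineMap
    (AffineMap.lineMap p.2 (p.2 + v))
  set h : ℝ → ℝ := (fun y => g (p.1, y) - μ / 2 * ‖y‖ ^ 2) ∘ (AffineMap.lineMap p.2 (p.2 + v))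
    with hh
  have hhe (t : ℝ) : h t = g (p + t • ((0, v) : X × Y)) - μ / 2 * ‖p.2 + t • v‖ ^ 2 := by
    have hY : AffineMap.lineMap p.2 (p.2 + v) t = p.2 + t • v := by
      simp [AffineMap.lineMap_apply, add_comm]
    have hXY : p + t • ((0, v) : X × Y) = (p.1, p.2 + t • v) := Prod.ext (by simp) (by simp)
    simp only [hh, Function.comp, hY, hXY]
  have hline (t : ℝ) : HasDerivAt (fun t : ℝ => p + t • ((0, v) : X × Y)) (0, v) t := by
    simpa using ((hasDerivAt_id t).smul_const ((0, v) : X × Y)).const_add p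
  have hlineY (t : ℝ) : HasDerivAt (fun t : ℝ => p.2 + t • v) v t := by
    simpa using ((hasDerivAt_id t).smul_const v).const_add p.2
  have hd (t : ℝ) : HasDerivAt h (fderiv ℝ g (p + t • ((0, v) : X × Y)) (0, v)
      - μ * inner ℝ (p.2 + t • v) v) t := by
    have h1 := ((hg.differentiable (by norm_num)) _).hasFDerivAt.comp_hasDerivAt t (hline t)
    have h2 := ((hlineY t).norm_sq).const_mul (μ / 2)
    rw [show h = fun t => g (p + t • ((0, v) : X × Y)) - μ / 2 * ‖p.2 + t • v‖ ^ 2 from funext hhe]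
    exact (h1.sub h2).congr_deriv (by ring)
  have hmono : Monotone (deriv h) := by
    rw [← monotoneOn_univ]
    exact (by simpa using hconv : ConvexOn ℝ Set.univ h).monotoneOn_deriv
      fun t _ => (hd t).differentiableAt
  have hdd : HasDerivAt (deriv h)
      (fderiv ℝ (fderiv ℝ g) p (0, v) (0, v) - μ * ‖v‖ ^ 2) 0 := by
    have heq : deriv h = fun t => fderiv ℝ g (p + t • ((0, v) : X × Y)) (0, v)
      - μ * inner ℝ (p.2 + t • v) v := funext fun t => (hd t).deriv
    rw [heq]
    have h1 := ((hasFDerivAt_fderiv hg _).comp_hasDerivAt (0 : ℝ) (hline 0)).clm_apply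
      (hasDerivAt_const (0 : ℝ) ((0, v) : X × Y))
    have h2 := (((hlineY 0).inner ℝ (hasDerivAt_const (0 : ℝ) v))).const_mul μ
    exact (h1.sub h2).congr_deriv (by simp)
  have := hmono.deriv_nonneg (x := 0)
  rw [hdd.deriv] at this
  linarith

lemma mul_norm_sq_le_of_hessian {g : X × Y → ℝ} (hg : ContDiff ℝ 2 g) {μ L : ℝ}
    (hL : ∀ p, ‖fderiv ℝ (fderiv ℝ g) p‖ ≤ L)
    (hμ : ∀ p v, μ * ‖v‖ ^ 2 ≤ fderiv ℝ (fderiv ℝ g) p (0, v) (0, v)) (x x' : X) (y y' : Y) :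
    μ * ‖y' - y‖ ^ 2 ≤ L * ‖x' - x‖ * ‖y' - y‖
      + (fderiv ℝ g (x', y') (0, y' - y) - fderiv ℝ g (x, y) (0, y' - y)) := by
  have h1 := le_meanHessian_apply_self hg (fun p => hμ p (y' - y)) (x, y) (x', y')
  have h2 := congrArg (fun T : X × Y →L[ℝ] ℝ => T (0, y' - y))
    (meanHessian_apply_sub hg (x, y) (x', y'))
  have hsplit : ((x', y') : X × Y) - (x, y) = (x' - x, 0) + (0, y' - y) := by simp
  rw [hsplit] at h2
  simp only [map_add, add_apply, sub_apply] at h2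
  have h3 := (meanHessian g (x, y) (x', y')).le_of_opNorm₂_le_of_le
    (norm_meanHessian_le hL (x, y) (x', y'))
    (le_refl ‖((x' - x, 0) : X × Y)‖) (le_refl ‖((0, y' - y) : X × Y)‖)
  simp only [Prod.norm_mk, norm_zero, norm_nonneg, sup_of_le_left, sup_of_le_right] at h3
  have := (abs_le.1 h3).1
  linarith

lemma exists_partial_stationary [CompleteSpace Y] (H : X × Y →L[ℝ] X × Y →L[ℝ] ℝ) {μ L : ℝ}
    (hμ0 : 0 < μ) (hL : ‖H‖ ≤ L) (hμ : ∀ v : Y, μ * ‖v‖ ^ 2 ≤ H (0, v) (0, v)) (u : X) :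
    ∃ v : Y, (∀ w : Y, H (u, v) (0, w) = 0) ∧ μ * ‖v‖ ≤ L * ‖u‖ := by
  let J : Y →L[ℝ] X × Y := ContinuousLinearMap.inr ℝ X Y
  let B : Y →L[ℝ] Y →L[ℝ] ℝ := H.bilinearComp J J
  have hB : IsCoercive B := ⟨μ, hμ0, fun v => by
    have := hμ v
    simp only [B, J, ContinuousLinearMap.bilinearComp_apply, ContinuousLinearMap.inr_apply]
    linarith⟩
  let r : Y := (InnerProductSpace.toDual ℝ Y).symm (-((H (u, 0)).comp J))
  obtain ⟨v, hv⟩ : ∃ v, hB.continuousLinearEquivOfBilin v = r :=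
    ⟨hB.continuousLinearEquivOfBilin.symm r, by simp⟩
  have hstat (w : Y) : H (u, v) (0, w) = 0 := by
    have h := hB.continuousLinearEquivOfBilin_apply v w
    rw [hv, InnerProductSpace.toDual_symm_apply] at h
    simp only [B, J, ContinuousLinearMap.bilinearComp_apply, ContinuousLinearMap.inr_apply,
      neg_apply, ContinuousLinearMap.comp_apply] at h
    have hsplit : ((u, v) : X × Y) = (u, 0) + (0, v) := by simp
    rw [hsplit, map_add, add_apply]
    linarith
  refine ⟨v, hstat, ?_⟩
  rcases (norm_nonneg v).eq_or_lt with h0 | hpos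
  · rw [← h0, mul_zero]
    exact mul_nonneg ((norm_nonneg _).trans hL) (norm_nonneg _)
  have h1 := hstat v
  have hsplit : ((u, v) : X × Y) = (u, 0) + (0, v) := by simp
  rw [hsplit, map_add, add_apply] at h1
  have h3 := H.le_of_opNorm₂_le_of_le hL
    (le_refl ‖((u, 0) : X × Y)‖) (le_refl ‖((0, v) : X × Y)‖)
  simp only [Prod.norm_mk, norm_zero, norm_nonneg, sup_of_le_left, sup_of_le_right] at h3
  have h4 := (abs_le.1 h3).1
  refine le_of_mul_le_mul_right ?_ hpos
  nlinarith [hμ v]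

/-- The envelope theorem, for a Lipschitz selection of partially critical points. -/
lemma hasFDerivAt_partialMin {Φ : X × Y → ℝ} {s : X → Y} {K : ℝ} {x : X}
    (hΦ : DifferentiableAt ℝ Φ (x, s x)) (hs : ∀ x', ‖s x' - s x‖ ≤ K * ‖x' - x‖)
    (hcrit : ∀ v, fderiv ℝ Φ (x, s x) (0, v) = 0) :
    HasFDerivAt (fun x' => Φ (x', s x'))
      ((fderiv ℝ Φ (x, s x)).comp (ContinuousLinearMap.inl ℝ X Y)) x := by
  have hO : (fun x' => (x', s x') - (x, s x)) =O[nhds x] fun x' => x' - x := by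
    refine Asymptotics.IsBigO.of_bound (max 1 K) (Filter.Eventually.of_forall fun x' => ?_)
    simp only [Prod.mk_sub_mk, Prod.norm_mk]
    refine max_le ?_ ((hs x').trans ?_)
    · nlinarith [le_max_left 1 K, norm_nonneg (x' - x)]
    · exact mul_le_mul_of_nonneg_right (le_max_right _ _) (norm_nonneg _)
  have hcont : Filter.Tendsto (fun x' => (x', s x')) (nhds x) (nhds (x, s x)) := by
    rw [← tendsto_sub_nhds_zero_iff]
    refine hO.trans_tendsto ?_
    rw [tendsto_sub_nhds_zero_iff]
    exact Filter.tendsto_id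
  have h := (hΦ.hasFDerivAt.isLittleO.comp_tendsto hcont).trans_isBigO hO
  refine HasFDerivAt.of_isLittleO (h.congr_left fun x' => ?_)
  have hsplit : ((x', s x') : X × Y) - (x, s x) = (x' - x, 0) + (0, s x' - s x) := by simp
  simp only [Function.comp, hsplit, map_add, hcrit, ContinuousLinearMap.comp_apply,
    ContinuousLinearMap.inl_apply, add_zero]

lemma fderiv_apply_inr_eq_zero_of_min {Φ : X × Y → ℝ} {x : X} {y : Y}
    (hΦ : DifferentiableAt ℝ Φ (x, y)) (hmin : ∀ y', Φ (x, y) ≤ Φ (x, y')) (v : Y) :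
    fderiv ℝ Φ (x, y) (0, v) = 0 := by
  have h1 : HasFDerivAt (fun y' => Φ (x, y'))
      ((fderiv ℝ Φ (x, y)).comp (ContinuousLinearMap.inr ℝ X Y)) y :=
    hΦ.hasFDerivAt.comp y (hasFDerivAt_prodMk_right x y)
  have h2 : IsLocalMin (fun y' => Φ (x, y')) y := Filter.Eventually.of_forall hmin
  simpa using congrArg (fun T : Y →L[ℝ] ℝ => T v) (h2.hasFDerivAt_eq_zero h1)

lemma abs_fderiv_apply_inr_le {f : X × Y → ℝ} {L : ℝ} {x : X} {y : Y}
    (hf : DifferentiableAt ℝ f (x, y)) (hL0 : 0 ≤ L)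
    (hL : ∀ y y', |f (x, y) - f (x, y')| ≤ L * ‖y - y'‖) (v : Y) :
    |fderiv ℝ f (x, y) (0, v)| ≤ L * ‖v‖ := by
  have h1 : HasFDerivAt (fun y' => f (x, y'))
      ((fderiv ℝ f (x, y)).comp (ContinuousLinearMap.inr ℝ X Y)) y :=
    hf.hasFDerivAt.comp y (hasFDerivAt_prodMk_right x y)
  lift L to NNReal using hL0
  have h2 := h1.le_of_lipschitz (LipschitzWith.of_dist_le_mul fun y y' => by
    simpa [dist_eq_norm] using hL y y')
  simpa using ((fderiv ℝ f (x, y)).comp (ContinuousLinearMap.inr ℝ X Y)).le_of_opNorm_le h2 v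

end PartialMinimization

lemma norm_prod_mk_le {X Y : Type*} [NormedAddCommGroup X] [NormedAddCommGroup Y] {u : X} {v : Y}
    {c r : ℝ} (hc : 1 ≤ c) (hu : ‖u‖ ≤ r) (hv : ‖v‖ ≤ c * r) :
    ‖(u, v)‖ ≤ c * r :=
  max_le (hu.trans (le_mul_of_one_le_left ((norm_nonneg _).trans hu) hc)) hv

section Penalty

set_option maxSynthPendingDepth 3

variable {X Y : Type*} [NormedAddCommGroup X] [NormedSpace ℝ X]
  [NormedAddCommGroup Y] [InnerProductSpace ℝ Y]

lemma norm_bestResponse_sub_le {G : X × Y → ℝ} (hG : ContDiff ℝ 2 G) {μ L : ℝ} (hμ0 : 0 < μ)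
    (hL : ∀ p, ‖fderiv ℝ (fderiv ℝ G) p‖ ≤ L)
    (hμ : ∀ p v, μ * ‖v‖ ^ 2 ≤ fderiv ℝ (fderiv ℝ G) p (0, v) (0, v)) {s : X → Y}
    (hs : ∀ x v, fderiv ℝ G (x, s x) (0, v) = 0) (x x' : X) :
    ‖s x' - s x‖ ≤ L / μ * ‖x' - x‖ := by
  have hL0 : 0 ≤ L := (norm_nonneg _).trans (hL 0)
  have h := mul_norm_sq_le_of_hessian hG hL hμ x x' (s x) (s x')
  rw [hs, hs, sub_zero, add_zero] at h
  rcases (norm_nonneg (s x' - s x)).eq_or_lt with h0 | hpos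
  · rw [← h0]
    positivity
  rw [div_mul_eq_mul_div, le_div_iff₀ hμ0]
  exact le_of_mul_le_mul_right (by linarith) hpos

lemma norm_regularizedResponse_sub_le {F G : X × Y → ℝ} (hG : ContDiff ℝ 2 G) {μ Lf L lam : ℝ}
    (hμ0 : 0 < μ) (hlam0 : 0 < lam) (hLf0 : 0 ≤ Lf) (hlam : 2 * Lf ≤ lam * μ)
    (hLf : ∀ p q, ‖fderiv ℝ F p - fderiv ℝ F q‖ ≤ Lf * ‖p - q‖)
    (hL : ∀ p, ‖fderiv ℝ (fderiv ℝ G) p‖ ≤ L)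
    (hμ : ∀ p v, μ * ‖v‖ ^ 2 ≤ fderiv ℝ (fderiv ℝ G) p (0, v) (0, v)) {s : X → Y}
    (hs : ∀ x v, fderiv ℝ F (x, s x) (0, v) + lam * fderiv ℝ G (x, s x) (0, v) = 0) (x x' : X) :
    ‖s x' - s x‖ ≤ (1 + 2 * L / μ) * ‖x' - x‖ := by
  have hL0 : 0 ≤ L := (norm_nonneg _).trans (hL 0)
  have h := mul_norm_sq_le_of_hessian hG hL hμ x x' (s x) (s x')
  have h1 := hs x (s x' - s x)
  have h2 := hs x' (s x' - s x)
  have hF := (fderiv ℝ F (x', s x') - fderiv ℝ F (x, s x)).le_of_opNorm_le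
    (hLf _ _) (0, s x' - s x)
  set a := s x' - s x with ha
  set u := x' - x with hu
  simp only [Prod.mk_sub_mk, ← ha, ← hu, Prod.norm_mk, norm_zero, norm_nonneg,
    sup_of_le_right, sub_apply] at hF
  have hF' := (abs_le.1 hF).1
  rcases (norm_nonneg a).eq_or_lt with h0 | hpos
  · rw [← h0]
    positivity
  have hmax : max ‖u‖ ‖a‖ ≤ ‖u‖ + ‖a‖ := max_le_add_of_nonneg (norm_nonneg _) (norm_nonneg _)
  have hm := mul_le_mul_of_nonneg_right (mul_le_mul_of_nonneg_left hmax hLf0) hpos.le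
  have h3 : lam * (μ * ‖a‖ ^ 2) ≤ lam * (L * ‖u‖ * ‖a‖) + Lf * (‖u‖ + ‖a‖) * ‖a‖ := by
    have := mul_le_mul_of_nonneg_left h hlam0.le
    linarith
  have h4 : (lam * μ - Lf) * ‖a‖ ≤ (lam * L + Lf) * ‖u‖ :=
    le_of_mul_le_mul_right (by linarith) hpos
  have hc : 0 < lam * μ / 2 := by positivity
  have h5 : lam * μ / 2 * ‖a‖ ≤ (lam * L + lam * μ / 2) * ‖u‖ := by
    have e1 : lam * μ / 2 * ‖a‖ ≤ (lam * μ - Lf) * ‖a‖ :=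
      mul_le_mul_of_nonneg_right (by linarith) hpos.le
    have e2 : (lam * L + Lf) * ‖u‖ ≤ (lam * L + lam * μ / 2) * ‖u‖ :=
      mul_le_mul_of_nonneg_right (by linarith) (norm_nonneg _)
    linarith
  refine le_of_mul_le_mul_left (h5.trans_eq ?_) hc
  field_simp
  ring

lemma norm_regularizedResponse_sub_bestResponse_le {F G : X × Y → ℝ} (hG : ContDiff ℝ 2 G)
    {μ Lf L lam : ℝ} (hμ0 : 0 < μ) (hlam0 : 0 < lam) (hLf0 : 0 ≤ Lf) {x : X} {y z : Y}
    (hLf : ∀ v, |fderiv ℝ F (x, z) (0, v)| ≤ Lf * ‖v‖)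
    (hL : ∀ p, ‖fderiv ℝ (fderiv ℝ G) p‖ ≤ L)
    (hμ : ∀ p v, μ * ‖v‖ ^ 2 ≤ fderiv ℝ (fderiv ℝ G) p (0, v) (0, v))
    (hy : ∀ v, fderiv ℝ G (x, y) (0, v) = 0)
    (hz : ∀ v, fderiv ℝ F (x, z) (0, v) + lam * fderiv ℝ G (x, z) (0, v) = 0) :
    ‖z - y‖ ≤ Lf / (lam * μ) := by
  have h := mul_norm_sq_le_of_hessian hG hL hμ x x y z
  rw [hy, sub_self, norm_zero, mul_zero, zero_mul, zero_add, sub_zero] at h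
  have h1 := hz (z - y)
  have h2 := (abs_le.1 (hLf (z - y))).1
  rcases (norm_nonneg (z - y)).eq_or_lt with h0 | hpos
  · rw [← h0]
    positivity
  rw [le_div_iff₀ (by positivity)]
  have h3 := mul_le_mul_of_nonneg_left h hlam0.le
  exact le_of_mul_le_mul_right (by linarith) hpos

/-- Lipschitz estimate for the derivative of the optimal penalty function. -/
lemma abs_penalty_fderiv_sub_le [CompleteSpace Y] {F G : X × Y → ℝ} (hG : ContDiff ℝ 2 G)
    {μ Lf0 Lf1 Lg1 Lg2 lam : ℝ} (hμ0 : 0 < μ) (hμL : μ ≤ Lg1) (hlam0 : 0 < lam)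
    (hLf00 : 0 ≤ Lf0) (hLf10 : 0 ≤ Lf1) (hLg20 : 0 ≤ Lg2) (hlam : 2 * Lf1 ≤ lam * μ)
    (hF0 : ∀ x y v, |fderiv ℝ F (x, y) (0, v)| ≤ Lf0 * ‖v‖)
    (hF1 : ∀ p q, ‖fderiv ℝ F p - fderiv ℝ F q‖ ≤ Lf1 * ‖p - q‖)
    (hG1 : ∀ p, ‖fderiv ℝ (fderiv ℝ G) p‖ ≤ Lg1)
    (hG2 : ∀ p q, ‖fderiv ℝ (fderiv ℝ G) p - fderiv ℝ (fderiv ℝ G) q‖ ≤ Lg2 * ‖p - q‖)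
    (hGμ : ∀ p v, μ * ‖v‖ ^ 2 ≤ fderiv ℝ (fderiv ℝ G) p (0, v) (0, v)) {s sl : X → Y}
    (hs : ∀ x v, fderiv ℝ G (x, s x) (0, v) = 0)
    (hsl : ∀ x v, fderiv ℝ F (x, sl x) (0, v) + lam * fderiv ℝ G (x, sl x) (0, v) = 0)
    (x x' w : X) :
    |(fderiv ℝ F (x', sl x') (w, 0) + lam * (fderiv ℝ G (x', sl x') (w, 0)
        - fderiv ℝ G (x', s x') (w, 0)))
      - (fderiv ℝ F (x, sl x) (w, 0) + lam * (fderiv ℝ G (x, sl x) (w, 0)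
        - fderiv ℝ G (x, s x) (w, 0)))|
      ≤ (Lf1 + Lf0 * Lg2 / μ) * ((1 + 2 * Lg1 / μ) * ‖x' - x‖) * (Lg1 / μ * ‖w‖) := by
  have hL0 : 0 ≤ Lg1 := hμ0.le.trans hμL
  have hδ (x : X) : ‖((x, sl x) : X × Y) - (x, s x)‖ ≤ Lf0 / (lam * μ) := by
    simpa using norm_regularizedResponse_sub_bestResponse_le hG hμ0 hlam0 hLf00 (hF0 x (sl x))
      hG1 hGμ (hs x) (hsl x)
  have hHdiff := norm_meanHessian_sub_le hG hLg20 hG2 (hδ x) (hδ x')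
  set H := meanHessian G (x, s x) (x', s x') with hH
  set K := meanHessian G (x, sl x) (x', sl x') with hK
  obtain ⟨v, hv, hvn⟩ := exists_partial_stationary H hμ0
    (norm_meanHessian_le hG1 (x, s x) (x', s x'))
    (fun v => le_meanHessian_apply_self hG (fun p => hGμ p v) _ _) w
  set d : X × Y := (x', sl x') - (x, sl x) with hd
  have hdn : ‖d‖ ≤ (1 + 2 * Lg1 / μ) * ‖x' - x‖ :=
    norm_prod_mk_le (by linarith [div_nonneg (mul_nonneg zero_le_two hL0) hμ0.le]) le_rfl
      (norm_regularizedResponse_sub_le hG hμ0 hlam0 hLf10 hlam hF1 hG1 hGμ hsl x x')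
  have hwn : ‖(w, v)‖ ≤ Lg1 / μ * ‖w‖ :=
    norm_prod_mk_le ((one_le_div hμ0).2 hμL) le_rfl (by
      rw [div_mul_eq_mul_div, le_div_iff₀ hμ0]
      linarith)
  have hKd : K d (w, v) = fderiv ℝ G (x', sl x') (w, v) - fderiv ℝ G (x, sl x) (w, v) := by
    rw [hK, hd, meanHessian_apply_sub hG, sub_apply]
  have hHd : H d (w, v) = fderiv ℝ G (x', s x') (w, v) - fderiv ℝ G (x, s x) (w, v) := by
    have hdec : d = ((x', s x') - (x, s x)) + (0, d.2 - (s x' - s x)) := by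
      ext1 <;> simp [hd]
    rw [hdec, map_add, add_apply, hH, meanHessian_apply_sub hG, meanHessian_comm hG _ _ (0, _),
      ← hH, hv, add_zero, sub_apply]
  have hsplit : ((w, v) : X × Y) = (w, 0) + (0, v) := by simp
  have hident : (fderiv ℝ F (x', sl x') (w, 0) + lam * (fderiv ℝ G (x', sl x') (w, 0)
        - fderiv ℝ G (x', s x') (w, 0)))
      - (fderiv ℝ F (x, sl x) (w, 0) + lam * (fderiv ℝ G (x, sl x) (w, 0)
        - fderiv ℝ G (x, s x) (w, 0)))
      = (fderiv ℝ F (x', sl x') - fderiv ℝ F (x, sl x)) (w, v) + lam * (K - H) d (w, v) := by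
    rw [sub_apply, sub_apply, sub_apply, hKd, hHd, hsplit]
    simp only [map_add, hs]
    linear_combination hsl x v - hsl x' v
  rw [hident]
  have hA := (fderiv ℝ F (x', sl x') - fderiv ℝ F (x, sl x)).le_of_opNorm_le_of_le
    ((hF1 _ _).trans (mul_le_mul_of_nonneg_left hdn hLf10)) hwn
  have hB := (K - H).le_of_opNorm₂_le_of_le hHdiff hdn hwn
  rw [Real.norm_eq_abs] at hA hB
  refine (abs_add_le _ _).trans ?_
  rw [abs_mul, abs_of_pos hlam0]
  refine (add_le_add hA (mul_le_mul_of_nonneg_left hB hlam0.le)).trans_eq ?_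
  field_simp

end Penalty

section Average

variable {E V : Type*} [NormedAddCommGroup E] [NormedSpace ℝ E]
  [NormedAddCommGroup V] [NormedSpace ℝ V] {n : ℕ}

lemma fderiv_average {f : Fin n → E → V} (hf : ∀ i, Differentiable ℝ (f i)) :
    fderiv ℝ (fun p => (1 / (n : ℝ)) • ∑ i, f i p)
      = fun p => (1 / (n : ℝ)) • ∑ i, fderiv ℝ (f i) p := by
  ext1 p
  exact ((HasFDerivAt.fun_sum fun i _ => (hf i p).hasFDerivAt).const_smul _).fderiv

lemma norm_average_sub_le (hn : 0 < n) {a b : Fin n → V} {C : ℝ} (h : ∀ i, ‖a i - b i‖ ≤ C) :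
    ‖(1 / (n : ℝ)) • ∑ i, a i - (1 / (n : ℝ)) • ∑ i, b i‖ ≤ C := by
  have hn' : (0 : ℝ) < n := by exact_mod_cast hn
  rw [← smul_sub, ← Finset.sum_sub_distrib, norm_smul, Real.norm_of_nonneg (by positivity)]
  have := norm_sum_le_of_le Finset.univ fun i _ => h i
  simp only [Finset.sum_const, Finset.card_univ, Fintype.card_fin, nsmul_eq_mul] at this
  calc _ ≤ 1 / (n : ℝ) * (n * C) := mul_le_mul_of_nonneg_left this (by positivity)
    _ = C := by field_simp

end Average

theorem stmt0
    (dx dy n : ℕ) (hdx : 0 < dx) (hdy : 0 < dy) (hn : 0 < n)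
    (f g : Fin n → Euc dx × Euc dy → ℝ)
    (Fb Gb : Euc dx × Euc dy → ℝ)
    (hFb : ∀ p, Fb p = (1 / (n : ℝ)) * ∑ i, f i p)
    (hGb : ∀ p, Gb p = (1 / (n : ℝ)) * ∑ i, g i p)
    (Lf0 Lf1 Lf2 Lg1 Lg2 μ : ℝ) (hμ : 0 < μ)
    (hfC2 : ∀ i, ContDiff ℝ 2 (f i)) (hgC2 : ∀ i, ContDiff ℝ 2 (g i))
    (hfLip : ∀ i x y y', |f i (x, y) - f i (x, y')| ≤ Lf0 * ‖y - y'‖)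
    (hfSmooth : ∀ i p q, ‖fderiv ℝ (f i) p - fderiv ℝ (f i) q‖ ≤ Lf1 * ‖p - q‖)
    (hfHess : ∀ i p q, ‖fderiv ℝ (fderiv ℝ (f i)) p - fderiv ℝ (fderiv ℝ (f i)) q‖ ≤ Lf2 * ‖p - q‖)
    (hgSC : ∀ i x, StrongConvexOn Set.univ μ (fun y => g i (x, y)))
    (hgSmooth : ∀ i p q, ‖fderiv ℝ (g i) p - fderiv ℝ (g i) q‖ ≤ Lg1 * ‖p - q‖)
    (hgHess : ∀ i p q, ‖fderiv ℝ (fderiv ℝ (g i)) p - fderiv ℝ (fderiv ℝ (g i)) q‖ ≤ Lg2 * ‖p - q‖)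
    (lam : ℝ) (hlam0 : 0 < lam)
    (ystar ystarl : Euc dx → Euc dy)
    (hystar : ∀ x y, Gb (x, ystar x) ≤ Gb (x, y))
    (hystarl : ∀ x y, Fb (x, ystarl x) + lam * Gb (x, ystarl x) ≤ Fb (x, y) + lam * Gb (x, y))
    (Lstar : Euc dx → ℝ)
    (hLstar : ∀ x, Lstar x = Fb (x, ystarl x) + lam * (Gb (x, ystarl x) - Gb (x, ystar x)))
    (hlam : 2 * Lf1 / μ ≤ lam) :
    ∀ x x' : Euc dx,
      ‖gradient Lstar x - gradient Lstar x'‖ ≤ ((Lf1 + 4 * Lf1 * Lg1 / μ + Lf0 * Lg2 / μ + Lf0 * Lg1 * Lg2 / μ ^ 2 + Lg1) * (1 / μ + 2 * Lg1 / μ ^ 2) * (Lf1 + Lf0 * Lg2 / μ)) * ‖x - x'‖ := by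
  have hn' : (0 : ℝ) < n := by exact_mod_cast hn
  have : Nonempty (Fin dx) := ⟨⟨0, hdx⟩⟩
  have : Nonempty (Fin dy) := ⟨⟨0, hdy⟩⟩
  let i₀ : Fin n := ⟨0, hn⟩
  obtain ⟨v₀, hv₀⟩ : ∃ v : Euc dy, v ≠ 0 := exists_ne 0
  have hv₀pos : 0 < ‖v₀‖ := norm_pos_iff.2 hv₀
  have hLf0 : 0 ≤ Lf0 := by
    have h := (abs_nonneg _).trans (hfLip i₀ 0 v₀ 0)
    rw [sub_zero] at h
    exact nonneg_of_mul_nonneg_left h hv₀pos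
  have hp₀pos : 0 < ‖((0, v₀) : Euc dx × Euc dy) - 0‖ := by
    simpa using hv₀
  have hLf1 : 0 ≤ Lf1 :=
    nonneg_of_mul_nonneg_left ((norm_nonneg _).trans (hfSmooth i₀ (0, v₀) 0)) hp₀pos
  have hLg1 : 0 ≤ Lg1 :=
    nonneg_of_mul_nonneg_left ((norm_nonneg _).trans (hgSmooth i₀ (0, v₀) 0)) hp₀pos
  set_option maxSynthPendingDepth 3 in
  have hLg2 : 0 ≤ Lg2 :=
    nonneg_of_mul_nonneg_left ((norm_nonneg _).trans (hgHess i₀ (0, v₀) 0)) hp₀pos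
  have hFe : Fb = fun p => (1 / (n : ℝ)) • ∑ i, f i p := funext hFb
  have hGe : Gb = fun p => (1 / (n : ℝ)) • ∑ i, g i p := funext hGb
  have hfd (i) : Differentiable ℝ (f i) := (hfC2 i).differentiable (by norm_num)
  have hgd (i) : Differentiable ℝ (g i) := (hgC2 i).differentiable (by norm_num)
  have hFC : ContDiff ℝ 2 Fb := by
    rw [hFe]
    exact (ContDiff.sum fun i _ => hfC2 i).const_smul _
  have hGC : ContDiff ℝ 2 Gb := by
    rw [hGe]
    exact (ContDiff.sum fun i _ => hgC2 i).const_smul _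
  have hFd : Differentiable ℝ Fb := hFC.differentiable (by norm_num)
  have hGd : Differentiable ℝ Gb := hGC.differentiable (by norm_num)
  have hF1e : fderiv ℝ Fb = fun p => (1 / (n : ℝ)) • ∑ i, fderiv ℝ (f i) p :=
    hFe ▸ fderiv_average hfd
  have hG1e : fderiv ℝ Gb = fun p => (1 / (n : ℝ)) • ∑ i, fderiv ℝ (g i) p :=
    hGe ▸ fderiv_average hgd
  have hG2e : fderiv ℝ (fderiv ℝ Gb)
      = fun p => (1 / (n : ℝ)) • ∑ i, fderiv ℝ (fderiv ℝ (g i)) p :=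
    hG1e ▸ fderiv_average fun i p => (hasFDerivAt_fderiv (hgC2 i) p).differentiableAt
  have hF1 (p q) : ‖fderiv ℝ Fb p - fderiv ℝ Fb q‖ ≤ Lf1 * ‖p - q‖ := by
    rw [hF1e]
    exact norm_average_sub_le hn fun i => hfSmooth i p q
  have hG1 (p) : ‖fderiv ℝ (fderiv ℝ Gb) p‖ ≤ Lg1 := by
    refine norm_fderiv_fderiv_le hLg1 (fun p q => ?_) p
    rw [hG1e]
    exact norm_average_sub_le hn fun i => hgSmooth i p q
  have hG2 (p q) : ‖fderiv ℝ (fderiv ℝ Gb) p - fderiv ℝ (fderiv ℝ Gb) q‖ ≤ Lg2 * ‖p - q‖ := by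
    rw [hG2e]
    exact norm_average_sub_le hn fun i => hgHess i p q
  have hGμ (p v) : μ * ‖v‖ ^ 2 ≤ fderiv ℝ (fderiv ℝ Gb) p (0, v) (0, v) := by
    have h := Finset.card_nsmul_le_sum Finset.univ
      (fun i => fderiv ℝ (fderiv ℝ (g i)) p (0, v) (0, v)) (μ * ‖v‖ ^ 2)
      fun i _ => le_hessian_of_strongConvexOn (hgC2 i) (hgSC i) p v
    simp only [Finset.card_univ, Fintype.card_fin, nsmul_eq_mul] at h
    simp only [hG2e, smul_apply, sum_apply, smul_eq_mul]
    rw [one_div_mul_eq_div, le_div_iff₀ hn']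
    linarith
  have hμL : μ ≤ Lg1 := by
    have h1 := hGμ 0 v₀
    have h2 := (fderiv ℝ (fderiv ℝ Gb) 0).le_of_opNorm₂_le_of_le (hG1 0)
      (le_refl ‖((0, v₀) : Euc dx × Euc dy)‖) (le_refl ‖((0, v₀) : Euc dx × Euc dy)‖)
    simp only [Prod.norm_mk, norm_zero, norm_nonneg, sup_of_le_right] at h2
    refine le_of_mul_le_mul_right (h1.trans ?_) (pow_pos hv₀pos 2)
    linarith [(abs_le.1 h2).2]
  have hF0 (x y v) : |fderiv ℝ Fb (x, y) (0, v)| ≤ Lf0 * ‖v‖ := by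
    refine abs_fderiv_apply_inr_le (hFd _) hLf0 (fun y y' => ?_) v
    rw [hFe]
    exact norm_average_sub_le (a := fun i => f i (x, y)) (b := fun i => f i (x, y')) hn
      fun i => hfLip i x y y'
  have hΦ (p) : HasFDerivAt (fun p => Fb p + lam * Gb p)
      (fderiv ℝ Fb p + lam • fderiv ℝ Gb p) p :=
    (hFd p).hasFDerivAt.add ((hGd p).hasFDerivAt.const_mul lam)
  have hs (x v) : fderiv ℝ Gb (x, ystar x) (0, v) = 0 :=
    fderiv_apply_inr_eq_zero_of_min (hGd _) (hystar x) v
  have hsl' (x v) : fderiv ℝ (fun p => Fb p + lam * Gb p) (x, ystarl x) (0, v) = 0 :=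
    fderiv_apply_inr_eq_zero_of_min (hΦ _).differentiableAt (hystarl x) v
  have hsl (x v) : fderiv ℝ Fb (x, ystarl x) (0, v)
      + lam * fderiv ℝ Gb (x, ystarl x) (0, v) = 0 := by
    have h := hsl' x v
    rw [(hΦ _).fderiv] at h
    simpa using h
  have hlam' : 2 * Lf1 ≤ lam * μ := (div_le_iff₀ hμ).1 hlam
  have hL (x : Euc dx) : HasFDerivAt Lstar
      ((fderiv ℝ Fb (x, ystarl x) + lam • fderiv ℝ Gb (x, ystarl x)).comp
          (ContinuousLinearMap.inl ℝ (Euc dx) (Euc dy))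
        - lam • (fderiv ℝ Gb (x, ystar x)).comp
          (ContinuousLinearMap.inl ℝ (Euc dx) (Euc dy))) x := by
    have h1 := hasFDerivAt_partialMin (hΦ _).differentiableAt
      (fun x' => norm_regularizedResponse_sub_le hGC hμ hlam0 hLf1 hlam' hF1 hG1 hGμ hsl x x')
      (hsl' x)
    have h2 := hasFDerivAt_partialMin (hGd _)
      (fun x' => norm_bestResponse_sub_le hGC hμ hG1 hGμ hs x x') (hs x)
    rw [(hΦ _).fderiv] at h1
    refine (h1.sub (h2.const_mul lam)).congr_of_eventuallyEq
      (Filter.Eventually.of_forall fun x' => ?_)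
    simp only [hLstar, Pi.sub_apply]
    ring
  intro x x'
  rw [gradient, gradient, ← map_sub, LinearIsometryEquiv.norm_map, (hL x).fderiv, (hL x').fderiv]
  have hκ : (Lf1 + Lf0 * Lg2 / μ) * (1 + 2 * Lg1 / μ) * (Lg1 / μ)
      ≤ (Lf1 + 4 * Lf1 * Lg1 / μ + Lf0 * Lg2 / μ + Lf0 * Lg1 * Lg2 / μ ^ 2 + Lg1)
        * (1 / μ + 2 * Lg1 / μ ^ 2) * (Lf1 + Lf0 * Lg2 / μ) := by
    have h1 : (Lf1 + Lf0 * Lg2 / μ) * (1 + 2 * Lg1 / μ) * (Lg1 / μ)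
        = Lg1 * (1 / μ + 2 * Lg1 / μ ^ 2) * (Lf1 + Lf0 * Lg2 / μ) := by
      field_simp
    rw [h1]
    gcongr
    exact le_add_of_nonneg_left (by positivity)
  refine (ContinuousLinearMap.opNorm_le_bound _ ?_ fun w => ?_).trans
    (mul_le_mul_of_nonneg_right hκ (norm_nonneg _))
  · positivity
  have h := abs_penalty_fderiv_sub_le hGC hμ hμL hlam0 hLf0 hLf1 hLg2 hlam' hF0 hF1 hG1 hG2 hGμ
    hs hsl x' x w
  rw [Real.norm_eq_abs]
  convert h using 1
  · congr 1
    simp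
    ring
  · ring
end
end

section
/- Assume λ ≥ 2L_{f,1}/μ and that 𝓛*_λ is L_{*,1}-smooth. Let W_k = ∑_{i=1}^n [α_{k+1}]_i · n[β_k]_i and Ω'_k = n²(max_i [α_{k+1}]_i)². Then for every k ≥ 0 the FAB iterates satisfy: 𝓛*_λ(x̂^{k+1}) − 𝓛*_λ(x̂^k) ≤ −(1/(2η_x^k W_k))‖x̂^{k+1} − x̂^k‖² + (L_{*,1}/2)‖x̂^{k+1} − x̂^k‖² + (η_x^k/(2W_k)) · ( 3λ²L_{g,1}² Ω'_k ‖ẑ^k − y*(x̂^k)‖² + 6(L_{f,1}² + λ²L_{g,1}²) Ω'_k ‖ŷ^k − y*_λ(x̂^k)‖² + 6 S(t_x^k, β_k) + (6L_{f,1}² + 12λ²L_{g,1}²)(n/min_i [α_k]_i) V_D^k ) − (η_x^k/2) W_k ‖∇𝓛*_λ(x̂^k)‖². -/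
open scoped BigOperators RealInnerProductSpace

set_option linter.unusedVariables false

noncomputable section

/-- A strongly convex differentiable function has a strongly monotone derivative. -/
lemma StrongConvexOn.mul_norm_sq_le_fderiv_sub {V : Type*} [NormedAddCommGroup V]
    [NormedSpace ℝ V] {m : ℝ} {φ : V → ℝ} {φ' : V → V →L[ℝ] ℝ}
    (hc : StrongConvexOn Set.univ m φ) (hd : ∀ y, HasFDerivAt φ (φ' y) y) (y y' : V) :
    m * ‖y - y'‖ ^ 2 ≤ (φ' y - φ' y') (y - y') := by
  have key : ∀ u v : V, φ u + φ' u (v - u) + m / 2 * ‖u - v‖ ^ 2 ≤ φ v := by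
    intro u v
    have h1 : HasDerivAt (fun t : ℝ => φ (u + t • (v - u))) (φ' u (v - u)) 0 := by
      have h2 : HasDerivAt (fun t : ℝ => u + t • (v - u)) (v - u) 0 := by
        simpa using ((hasDerivAt_id (0 : ℝ)).smul_const (v - u)).const_add u
      have h3 : HasFDerivAt φ (φ' u) (u + (0 : ℝ) • (v - u)) := by simpa using hd u
      exact h3.comp_hasDerivAt (0 : ℝ) h2
    have h4 := h1.tendsto_slope_zero_right
    have h5 : Filter.Tendsto (fun t : ℝ => φ v - φ u - (1 - t) * (m / 2 * ‖u - v‖ ^ 2))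
        (nhdsWithin 0 (Set.Ioi 0)) (nhds (φ v - φ u - (1 - 0) * (m / 2 * ‖u - v‖ ^ 2))) := by
      refine Filter.Tendsto.mono_left (Continuous.tendsto ?_ 0) nhdsWithin_le_nhds
      fun_prop
    have h6 := le_of_tendsto_of_tendsto h4 h5 (by
      filter_upwards [Ioo_mem_nhdsGT (zero_lt_one' ℝ)] with t ht
      have h7 := hc.2 (Set.mem_univ u) (Set.mem_univ v) (sub_nonneg.2 ht.2.le) ht.1.le
        (by ring)
      have h8 : (1 - t) • u + t • v = u + t • (v - u) := by module
      rw [h8] at h7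
      simp only [zero_add, zero_smul, add_zero, smul_eq_mul] at h7 ⊢
      rw [inv_mul_le_iff₀ ht.1]
      nlinarith)
    linarith
  have h1 := key y y'
  have h2 := key y' y
  have h3 : φ' y (y' - y) = - φ' y (y - y') := by rw [← map_neg, neg_sub]
  rw [norm_sub_rev y' y] at h2
  rw [_root_.sub_apply]
  linarith

/-- The descent lemma for functions with Lipschitz gradient. -/
lemma le_add_inner_gradient_add_sq {V : Type*} [NormedAddCommGroup V] [InnerProductSpace ℝ V]
    [CompleteSpace V] {h : V → ℝ} {L : ℝ} (hd : Differentiable ℝ h)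
    (hL : ∀ u v, ‖gradient h u - gradient h v‖ ≤ L * ‖u - v‖) (u v : V) :
    h v ≤ h u + ⟪gradient h u, v - u⟫ + L / 2 * ‖v - u‖ ^ 2 := by
  set w := v - u with hw
  have hder : ∀ t : ℝ, HasDerivAt
      (fun t : ℝ => h (u + t • w) - t * ⟪gradient h u, w⟫ - L / 2 * ‖w‖ ^ 2 * t ^ 2)
      (⟪gradient h (u + t • w), w⟫ - ⟪gradient h u, w⟫ - L * ‖w‖ ^ 2 * t) t := by
    intro t
    have h2 : HasDerivAt (fun t : ℝ => u + t • w) w t := by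
      simpa using ((hasDerivAt_id t).smul_const w).const_add u
    have h3 := (hd (u + t • w)).hasGradientAt.hasFDerivAt.comp_hasDerivAt t h2
    have h4 := (h3.sub ((hasDerivAt_id t).mul_const ⟪gradient h u, w⟫)).sub
      (((hasDerivAt_id t).pow 2).const_mul (L / 2 * ‖w‖ ^ 2))
    refine h4.congr_deriv ?_
    simp only [InnerProductSpace.toDual_apply_apply, id]
    ring
  have hanti : AntitoneOn
      (fun t : ℝ => h (u + t • w) - t * ⟪gradient h u, w⟫ - L / 2 * ‖w‖ ^ 2 * t ^ 2)
      (Set.Icc 0 1) := by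
    refine antitoneOn_of_deriv_nonpos (convex_Icc 0 1)
      (fun t _ => (hder t).continuousAt.continuousWithinAt)
      (fun t _ => (hder t).differentiableAt.differentiableWithinAt) fun t ht => ?_
    rw [interior_Icc] at ht
    rw [(hder t).deriv, ← inner_sub_left]
    have h1 := real_inner_le_norm (gradient h (u + t • w) - gradient h u) w
    have h2 := hL (u + t • w) u
    rw [add_sub_cancel_left, norm_smul, Real.norm_of_nonneg ht.1.le] at h2
    nlinarith [mul_le_mul_of_nonneg_right h2 (norm_nonneg w)]
  have := hanti (Set.left_mem_Icc.2 zero_le_one) (Set.right_mem_Icc.2 zero_le_one) zero_le_one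
  simp only [one_smul, zero_smul, add_zero, hw, add_sub_cancel] at this
  rw [← hw] at this
  linarith

/-- Envelope theorem for a partial minimization of a function whose derivative is Lipschitz and
strongly monotone in the minimized variable. -/
lemma hasFDerivAt_partial_min {V W : Type*} [NormedAddCommGroup V] [NormedSpace ℝ V]
    [NormedAddCommGroup W] [NormedSpace ℝ W] {Φ : V × W → ℝ} {Φ' : V × W → (V × W →L[ℝ] ℝ)}
    {M m : ℝ} (hm : 0 < m) (hΦ : ∀ p, HasFDerivAt Φ (Φ' p) p)
    (hM : ∀ p q, ‖Φ' p - Φ' q‖ ≤ M * ‖p - q‖)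
    (hmono : ∀ x y y', m * ‖y - y'‖ ^ 2 ≤ (Φ' (x, y) - Φ' (x, y')) (0, y - y'))
    {ys : V → W} (hys : ∀ x y, Φ (x, ys x) ≤ Φ (x, y)) (x : V) :
    HasFDerivAt (fun x => Φ (x, ys x))
      ((Φ' (x, ys x)).comp (ContinuousLinearMap.inl ℝ V W)) x := by
  have hzero : ∀ x v, Φ' (x, ys x) (0, v) = 0 := by
    intro x v
    have h1 : HasFDerivAt (fun y => Φ (x, y))
        ((Φ' (x, ys x)).comp (ContinuousLinearMap.inr ℝ V W)) (ys x) :=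
      (hΦ (x, ys x)).comp (ys x) (hasFDerivAt_prodMk_right x (ys x))
    have h2 : IsLocalMin (fun y => Φ (x, y)) (ys x) := Filter.Eventually.of_forall (hys x)
    simpa using DFunLike.congr_fun (h2.hasFDerivAt_eq_zero h1) v
  have hlip : ∀ x', ‖ys x' - ys x‖ ≤ M / m * ‖x' - x‖ := by
    intro x'
    have h1 := hmono x' (ys x') (ys x)
    have h2 : (Φ' (x', ys x') - Φ' (x', ys x)) (0, ys x' - ys x)
        = -(Φ' (x', ys x) - Φ' (x, ys x)) (0, ys x' - ys x) := by
      simp [hzero]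
    have h3 := (Φ' (x', ys x) - Φ' (x, ys x)).le_opNorm (0, ys x' - ys x)
    have h4 := hM (x', ys x) (x, ys x)
    have h5 : ‖((x', ys x) : V × W) - (x, ys x)‖ = ‖x' - x‖ := by simp [Prod.norm_def]
    have h6 : ‖((0 : V), ys x' - ys x)‖ = ‖ys x' - ys x‖ := by simp [Prod.norm_def]
    rw [h5] at h4
    rw [h6] at h3
    have h7 := neg_le_abs ((Φ' (x', ys x) - Φ' (x, ys x)) (0, ys x' - ys x))
    rw [← Real.norm_eq_abs] at h7
    have h8 := mul_le_mul_of_nonneg_right h4 (norm_nonneg (ys x' - ys x))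
    rw [div_mul_eq_mul_div, le_div_iff₀ hm]
    rcases (norm_nonneg (ys x' - ys x)).eq_or_lt with h0 | h0
    · rw [← h0, zero_mul]; exact (norm_nonneg _).trans h4
    · refine le_of_mul_le_mul_right ?_ h0
      nlinarith
  have hO : (fun x' => ((x', ys x') : V × W) - (x, ys x)) =O[nhds x] fun x' => x' - x := by
    refine Asymptotics.IsBigO.of_bound (max 1 (M / m)) (Filter.Eventually.of_forall fun x' => ?_)
    rw [Prod.mk_sub_mk, Prod.norm_mk, max_mul_of_nonneg _ _ (norm_nonneg _), one_mul]
    exact max_le_max le_rfl (hlip x')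
  have htend : Filter.Tendsto (fun x' => ((x', ys x') : V × W)) (nhds x) (nhds (x, ys x)) := by
    rw [tendsto_iff_norm_sub_tendsto_zero, ← tendsto_zero_iff_norm_tendsto_zero]
    refine hO.trans_tendsto ?_
    have : Filter.Tendsto (fun x' => x' - x) (nhds x) (nhds (x - x)) :=
      (continuous_id.sub continuous_const).tendsto x
    rwa [sub_self] at this
  refine .of_isLittleO ?_
  have h := ((hΦ (x, ys x)).isLittleO.comp_tendsto htend).trans_isBigO hO
  refine h.congr_left fun x' => ?_
  have h1 : ((x', ys x') : V × W) - (x, ys x) = (x' - x, 0) + (0, ys x' - ys x) := by simp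
  simp only [Function.comp_apply, h1, map_add, hzero]
  simp

section PartialGradient

variable {dx dy : ℕ} {f : Euc dx × Euc dy → ℝ}

lemma inner_gradX (hf : Differentiable ℝ f) (x : Euc dx) (y : Euc dy) (u : Euc dx) :
    ⟪gradX f x y, u⟫ = fderiv ℝ f (x, y) (u, 0) := by
  have h1 : HasFDerivAt (fun x' => f (x', y))
      ((fderiv ℝ f (x, y)).comp (ContinuousLinearMap.inl ℝ (Euc dx) (Euc dy))) x :=
    (hf (x, y)).hasFDerivAt.comp x (hasFDerivAt_prodMk_left x y)
  rw [gradX, inner_gradient_left, h1.fderiv]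
  simp

lemma norm_gradX_sub_le (hf : Differentiable ℝ f) {L : ℝ}
    (hL : ∀ p q, ‖fderiv ℝ f p - fderiv ℝ f q‖ ≤ L * ‖p - q‖) (x x' : Euc dx) (y y' : Euc dy) :
    ‖gradX f x y - gradX f x' y'‖ ≤ L * max ‖x - x'‖ ‖y - y'‖ := by
  set w := gradX f x y - gradX f x' y' with hw
  have h1 : ‖w‖ ^ 2 = (fderiv ℝ f (x, y) - fderiv ℝ f (x', y')) (w, 0) := by
    rw [← real_inner_self_eq_norm_sq]
    nth_rw 1 [hw]
    rw [inner_sub_left, inner_gradX hf, inner_gradX hf, _root_.sub_apply]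
  have h2 := (le_abs_self _).trans
    ((fderiv ℝ f (x, y) - fderiv ℝ f (x', y')).le_opNorm (w, 0))
  have h3 : ‖(w, (0 : Euc dy))‖ = ‖w‖ := by simp [Prod.norm_def]
  have h4 := hL (x, y) (x', y')
  rw [Prod.mk_sub_mk, Prod.norm_mk] at h4
  rw [h3, ← h1] at h2
  rcases (norm_nonneg w).eq_or_lt with h0 | h0
  · rw [← h0]; exact (norm_nonneg _).trans h4
  · refine le_trans (le_of_mul_le_mul_right ?_ h0) h4
    nlinarith

/-- Strong convexity in `y` improves the Lipschitz constant in `y` of the partial gradient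
in `x`, since both partial gradients together move by at most `L * ‖y - y'‖`. -/
lemma norm_gradX_sub_le_of_strongConvex (hf : Differentiable ℝ f) {L μ : ℝ} (hμL : μ ≤ L)
    (hL : ∀ p q, ‖fderiv ℝ f p - fderiv ℝ f q‖ ≤ L * ‖p - q‖) (x : Euc dx) (y y' : Euc dy)
    (hmono : μ * ‖y - y'‖ ^ 2 ≤ (fderiv ℝ f (x, y) - fderiv ℝ f (x, y')) (0, y - y')) :
    ‖gradX f x y - gradX f x y'‖ ≤ (L - μ) * ‖y - y'‖ := by
  set w := gradX f x y - gradX f x y' with hw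
  set D := fderiv ℝ f (x, y) - fderiv ℝ f (x, y') with hD
  have h1 : ‖w‖ ^ 2 = D (w, 0) := by
    rw [← real_inner_self_eq_norm_sq]
    nth_rw 1 [hw]
    rw [inner_sub_left, inner_gradX hf, inner_gradX hf, hD, _root_.sub_apply]
  rcases (norm_nonneg w).eq_or_lt with h0 | h0
  · rw [← h0]; exact mul_nonneg (sub_nonneg.2 hμL) (norm_nonneg _)
  have h4 := hL (x, y) (x, y')
  rw [Prod.mk_sub_mk, Prod.norm_mk, sub_self, norm_zero, max_eq_right (norm_nonneg _)] at h4
  rcases (norm_nonneg (y - y')).eq_or_lt with hv | hv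
  · rw [← hv, mul_zero] at h4 ⊢
    have := norm_le_zero_iff.1 h4
    have h5 : ‖w‖ ^ 2 = 0 := by rw [h1, hD, this]; simp
    nlinarith
  have h2 := (le_abs_self _).trans (D.le_opNorm (‖y - y'‖ • w, ‖w‖ • (y - y')))
  have h3 : ‖(‖y - y'‖ • w, ‖w‖ • (y - y'))‖ = ‖y - y'‖ * ‖w‖ := by
    simp [Prod.norm_def, norm_smul, mul_comm]
  have h5 : D (‖y - y'‖ • w, ‖w‖ • (y - y'))
      = ‖y - y'‖ * D (w, 0) + ‖w‖ * D (0, y - y') := by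
    have : (‖y - y'‖ • w, ‖w‖ • (y - y')) = ‖y - y'‖ • (w, 0) + ‖w‖ • (0, y - y') := by simp
    rw [this, map_add, map_smul, map_smul, smul_eq_mul, smul_eq_mul]
  rw [h3, h5, ← h1] at h2
  have h6 := mul_le_mul_of_nonneg_right h4 (mul_pos hv h0).le
  have h7 := mul_le_mul_of_nonneg_left hmono h0.le
  refine le_of_mul_le_mul_right ?_ (mul_pos hv h0)
  nlinarith

end PartialGradient

/-- Weighted Cauchy–Schwarz with the weights `Q`, `2 * (P + Q)`, `Q + 2 * P`, `2 * (Q - 2 * P)`,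
which sum to `6 * Q`. -/
lemma sq_add_four_le {P Q s k y z : ℝ} (hP : 0 ≤ P) (hPQ : 2 * P ≤ Q) (hQ : 0 < Q) :
    (s + (P + 2 * Q) * k + (P + Q) * y + (Q - 2 * P) * z) ^ 2
      ≤ 6 * s ^ 2 + (6 * P ^ 2 + 12 * Q ^ 2) * k ^ 2 + 6 * (P ^ 2 + Q ^ 2) * y ^ 2
        + 3 * Q ^ 2 * z ^ 2 := by
  have hCS : ∀ u v w t : ℝ, (Q * u + 2 * (P + Q) * v + (Q + 2 * P) * w
      + 2 * (Q - 2 * P) * t) ^ 2 ≤ 6 * Q * (Q * u ^ 2 + 2 * (P + Q) * v ^ 2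
        + (Q + 2 * P) * w ^ 2 + 2 * (Q - 2 * P) * t ^ 2) := by
    intro u v w t
    have ha : 0 ≤ Q - 2 * P := by linarith
    have e1 : 0 ≤ Q * (P + Q) := by positivity
    have e2 : 0 ≤ Q * (Q + 2 * P) := by positivity
    have e3 : 0 ≤ Q * (Q - 2 * P) := by positivity
    have e4 : 0 ≤ (P + Q) * (Q + 2 * P) := by positivity
    have e5 : 0 ≤ (P + Q) * (Q - 2 * P) := by positivity
    have e6 : 0 ≤ (Q + 2 * P) * (Q - 2 * P) := by positivity
    nlinarith [mul_nonneg e1 (sq_nonneg (u - v)), mul_nonneg e2 (sq_nonneg (u - w)),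
      mul_nonneg e3 (sq_nonneg (u - t)), mul_nonneg e4 (sq_nonneg (v - w)),
      mul_nonneg e5 (sq_nonneg (v - t)), mul_nonneg e6 (sq_nonneg (w - t))]
  have hPQ' : 0 < P + Q := by linarith
  have hQP : 0 < Q + 2 * P := by linarith
  have h := hCS (s / Q) ((P + 2 * Q) * k / (2 * (P + Q))) ((P + Q) * y / (Q + 2 * P)) (z / 2)
  have e : Q * (s / Q) + 2 * (P + Q) * ((P + 2 * Q) * k / (2 * (P + Q)))
      + (Q + 2 * P) * ((P + Q) * y / (Q + 2 * P)) + 2 * (Q - 2 * P) * (z / 2)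
      = s + (P + 2 * Q) * k + (P + Q) * y + (Q - 2 * P) * z := by
    field_simp
  rw [e] at h
  refine h.trans ?_
  have t1 : 6 * Q * (Q * (s / Q) ^ 2) = 6 * s ^ 2 := by field_simp
  have t2 : 6 * Q * (2 * (P + Q) * ((P + 2 * Q) * k / (2 * (P + Q))) ^ 2)
      ≤ (6 * P ^ 2 + 12 * Q ^ 2) * k ^ 2 := by
    have : 6 * Q * (2 * (P + Q) * ((P + 2 * Q) * k / (2 * (P + Q))) ^ 2)
        = (3 * Q * (P + 2 * Q) ^ 2 / (P + Q)) * k ^ 2 := by field_simp; ring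
    rw [this]
    refine mul_le_mul_of_nonneg_right ?_ (sq_nonneg k)
    rw [div_le_iff₀ hPQ']
    nlinarith [pow_nonneg hP 3, mul_nonneg (sq_nonneg P) hQ.le]
  have t3 : 6 * Q * ((Q + 2 * P) * ((P + Q) * y / (Q + 2 * P)) ^ 2)
      ≤ 6 * (P ^ 2 + Q ^ 2) * y ^ 2 := by
    have : 6 * Q * ((Q + 2 * P) * ((P + Q) * y / (Q + 2 * P)) ^ 2)
        = (6 * Q * (P + Q) ^ 2 / (Q + 2 * P)) * y ^ 2 := by field_simp
    rw [this]
    refine mul_le_mul_of_nonneg_right ?_ (sq_nonneg y)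
    rw [div_le_iff₀ hQP]
    nlinarith [pow_nonneg hP 3, mul_nonneg (sq_nonneg P) hQ.le]
  have t4 : 6 * Q * (2 * (Q - 2 * P) * (z / 2) ^ 2) ≤ 3 * Q ^ 2 * z ^ 2 := by
    nlinarith [mul_nonneg (mul_nonneg hP hQ.le) (sq_nonneg z)]
  linarith
lemma gradX_add_smul {dx dy : ℕ} {f g : Euc dx × Euc dy → ℝ} (hf : Differentiable ℝ f)
    (hg : Differentiable ℝ g) (c : ℝ) (x : Euc dx) (y : Euc dy) :
    gradX (fun p => f p + c * g p) x y = gradX f x y + c • gradX g x y := by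
  refine ext_inner_right ℝ fun u => ?_
  rw [inner_gradX (hf.fun_add (hg.const_mul c)), inner_add_left, inner_smul_left, inner_gradX hf,
    inner_gradX hg, fderiv_fun_add (hf _) ((hg _).const_mul c), fderiv_const_mul (hg _)]
  simp

/-- The gradient of the partial minimum of an average of strongly monotone functions. -/
lemma hasGradientAt_average_min {dx dy n : ℕ} (hn : 0 < n) {φ : Fin n → Euc dx × Euc dy → ℝ}
    {M m : ℝ} (hm : 0 < m) (hφ : ∀ i, Differentiable ℝ (φ i))
    (hM : ∀ i p q, ‖fderiv ℝ (φ i) p - fderiv ℝ (φ i) q‖ ≤ M * ‖p - q‖)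
    (hmono : ∀ i x y y', m * ‖y - y'‖ ^ 2
      ≤ (fderiv ℝ (φ i) (x, y) - fderiv ℝ (φ i) (x, y')) (0, y - y'))
    {Φ : Euc dx × Euc dy → ℝ} (hΦ : ∀ p, Φ p = (1 / (n : ℝ)) * ∑ i, φ i p)
    {ys : Euc dx → Euc dy} (hys : ∀ x y, Φ (x, ys x) ≤ Φ (x, y)) (x : Euc dx) :
    HasGradientAt (fun x => Φ (x, ys x)) ((1 / (n : ℝ)) • ∑ i, gradX (φ i) x (ys x)) x := by
  have hn' : (0 : ℝ) < n := by exact_mod_cast hn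
  have hsub : ∀ p q, (1 / (n : ℝ)) • ∑ i, fderiv ℝ (φ i) p - (1 / (n : ℝ)) • ∑ i, fderiv ℝ (φ i) q
      = (1 / (n : ℝ)) • ∑ i, (fderiv ℝ (φ i) p - fderiv ℝ (φ i) q) := by
    intro p q
    simp only [Finset.sum_sub_distrib, smul_sub]
  have hΦ' : Φ = fun p => (1 / (n : ℝ)) * ∑ i, φ i p := funext hΦ
  have h := hasFDerivAt_partial_min (Φ := Φ)
    (Φ' := fun p => (1 / (n : ℝ)) • ∑ i, fderiv ℝ (φ i) p) (M := M) hm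
    (fun p => by
      rw [hΦ']
      exact (HasFDerivAt.fun_sum fun i _ => (hφ i p).hasFDerivAt).const_mul _)
    (fun p q => by
      rw [hsub, norm_smul, Real.norm_of_nonneg (by positivity), one_div, inv_mul_le_iff₀ hn']
      refine (norm_sum_le_of_le _ fun i _ => hM i p q).trans ?_
      simp)
    (fun x y y' => by
      rw [hsub, _root_.smul_apply, _root_.sum_apply, smul_eq_mul,
        one_div, le_inv_mul_iff₀ hn']
      have := Finset.sum_le_sum fun i (_ : i ∈ Finset.univ) => hmono i x y y'
      simpa using this)
    hys x
  rw [hasGradientAt_iff_hasFDerivAt]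
  refine h.congr_fderiv ?_
  ext u
  simp [inner_gradX (hφ _)]

lemma norm_sum_smul_sub_sq_le_trackS {n : ℕ} {V : Type*} [NormedAddCommGroup V]
    [NormedSpace ℝ V] {a b : Fin n → ℝ} (ha0 : ∀ i, 0 ≤ a i) (ha1 : ∀ i, a i ≤ 1)
    (hb0 : ∀ i, 0 < b i) (hb1 : ∑ i, b i = 1) (t : Fin n → V) :
    ‖∑ i, a i • t i - (∑ i, a i * b i) • ∑ l, t l‖ ^ 2 ≤ trackS b t := by
  have h1 : ∑ i, a i • t i - (∑ i, a i * b i) • ∑ l, t l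
      = ∑ i, (a i * b i) • ((b i)⁻¹ • t i - ∑ l, t l) := by
    rw [Finset.sum_smul, ← Finset.sum_sub_distrib]
    refine Finset.sum_congr rfl fun i _ => ?_
    rw [smul_sub, smul_smul, mul_assoc, mul_inv_cancel₀ (hb0 i).ne', mul_one]
  have h2 : ‖∑ i, (a i * b i) • ((b i)⁻¹ • t i - ∑ l, t l)‖
      ≤ ∑ i, b i * ‖(b i)⁻¹ • t i - ∑ l, t l‖ := by
    refine norm_sum_le_of_le _ fun i _ => ?_
    rw [norm_smul, Real.norm_of_nonneg (mul_nonneg (ha0 i) (hb0 i).le)]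
    gcongr
    exact mul_le_of_le_one_left (hb0 i).le (ha1 i)
  rw [h1, trackS]
  exact (pow_le_pow_left₀ (norm_nonneg _) h2 2).trans
    (Real.pow_arith_mean_le_arith_mean_pow _ _ _ (fun i _ => (hb0 i).le) hb1
      (fun i _ => norm_nonneg _) 2)

/-- A sum of vectors is controlled by a weighted sum of squares bounding their norms. -/
lemma norm_sum_sq_le_of_weights {n : ℕ} (hn : 0 < n) {V : Type*} [NormedAddCommGroup V]
    [NormedSpace ℝ V] {w : Fin n → ℝ} (hw : ∀ i, 0 < w i) {v : Fin n → V} {c : ℝ}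
    {r : Fin n → ℝ} (hr : ∀ i, 0 ≤ r i) (hv : ∀ i, ‖v i‖ ^ 2 ≤ c ^ 2 * r i) :
    ‖∑ i, v i‖ ^ 2 ≤ c ^ 2 * ((n : ℝ) / (⨅ i, w i) * ∑ i, w i * r i) := by
  have : Nonempty (Fin n) := ⟨⟨0, hn⟩⟩
  have hmin : 0 < ⨅ i, w i := by
    obtain ⟨i, hi⟩ := exists_eq_ciInf_of_finite (f := w)
    rw [← hi]; exact hw i
  have h1 : ‖∑ i, v i‖ ^ 2 ≤ n * ∑ i, ‖v i‖ ^ 2 := by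
    refine (pow_le_pow_left₀ (norm_nonneg _) (norm_sum_le _ _) 2).trans ?_
    simpa using sq_sum_le_card_mul_sum_sq (s := (Finset.univ : Finset (Fin n)))
      (f := fun i => ‖v i‖)
  have h2 : (⨅ i, w i) * ∑ i, r i ≤ ∑ i, w i * r i := by
    rw [Finset.mul_sum]
    exact Finset.sum_le_sum fun i _ =>
      mul_le_mul_of_nonneg_right (ciInf_le (Set.finite_range w).bddBelow i) (hr i)
  have h3 : ∑ i, r i ≤ (∑ i, w i * r i) / (⨅ i, w i) := by
    rw [le_div_iff₀ hmin]; linarith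
  calc ‖∑ i, v i‖ ^ 2 ≤ n * ∑ i, ‖v i‖ ^ 2 := h1
    _ ≤ n * ∑ i, c ^ 2 * r i := by gcongr with i; exact hv i
    _ = n * c ^ 2 * ∑ i, r i := by rw [← Finset.mul_sum]; ring
    _ ≤ n * c ^ 2 * ((∑ i, w i * r i) / (⨅ i, w i)) := by gcongr
    _ = c ^ 2 * ((n : ℝ) / (⨅ i, w i) * ∑ i, w i * r i) := by ring

/-- The gradient trackers sum to the tracked directions when the mixing is column-stochastic. -/
lemma sum_tracker_eq {n : ℕ} {V : Type*} [AddCommGroup V] [Module ℝ V]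
    {B : ℕ → Fin n → Fin n → ℝ} (hB : ∀ k j, ∑ i, B k i j = 1) {t d : ℕ → Fin n → V}
    (ht : ∀ k i, t (k + 1) i = (∑ j, B k i j • t k j) + d (k + 1) i - d k i)
    (h0 : ∀ i, t 0 i = d 0 i) (k : ℕ) : ∑ i, t k i = ∑ i, d k i := by
  induction k with
  | zero => simp [h0]
  | succ k ih =>
    simp only [ht, Finset.sum_sub_distrib, Finset.sum_add_distrib]
    rw [Finset.sum_comm]
    simp only [← Finset.sum_smul, hB, one_smul, ih]
    abel

set_option maxHeartbeats 1000000 in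
theorem stmt2
    (dx dy n : ℕ) (hdx : 0 < dx) (hdy : 0 < dy) (hn : 0 < n)
    (f g : Fin n → Euc dx × Euc dy → ℝ)
    (Fb Gb : Euc dx × Euc dy → ℝ)
    (hFb : ∀ p, Fb p = (1 / (n : ℝ)) * ∑ i, f i p)
    (hGb : ∀ p, Gb p = (1 / (n : ℝ)) * ∑ i, g i p)
    (Lf0 Lf1 Lf2 Lg1 Lg2 μ : ℝ) (hμ : 0 < μ)
    (hfC2 : ∀ i, ContDiff ℝ 2 (f i)) (hgC2 : ∀ i, ContDiff ℝ 2 (g i))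
    (hfLip : ∀ i x y y', |f i (x, y) - f i (x, y')| ≤ Lf0 * ‖y - y'‖)
    (hfSmooth : ∀ i p q, ‖fderiv ℝ (f i) p - fderiv ℝ (f i) q‖ ≤ Lf1 * ‖p - q‖)
    (hfHess : ∀ i p q, ‖fderiv ℝ (fderiv ℝ (f i)) p - fderiv ℝ (fderiv ℝ (f i)) q‖ ≤ Lf2 * ‖p - q‖)
    (hgSC : ∀ i x, StrongConvexOn Set.univ μ (fun y => g i (x, y)))
    (hgSmooth : ∀ i p q, ‖fderiv ℝ (g i) p - fderiv ℝ (g i) q‖ ≤ Lg1 * ‖p - q‖)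
    (hgHess : ∀ i p q, ‖fderiv ℝ (fderiv ℝ (g i)) p - fderiv ℝ (fderiv ℝ (g i)) q‖ ≤ Lg2 * ‖p - q‖)
    (lam : ℝ) (hlam0 : 0 < lam)
    (ystar ystarl : Euc dx → Euc dy)
    (hystar : ∀ x y, Gb (x, ystar x) ≤ Gb (x, y))
    (hystarl : ∀ x y, Fb (x, ystarl x) + lam * Gb (x, ystarl x) ≤ Fb (x, y) + lam * Gb (x, y))
    (Lstar : Euc dx → ℝ)
    (hLstar : ∀ x, Lstar x = Fb (x, ystarl x) + lam * (Gb (x, ystarl x) - Gb (x, ystar x)))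
    (a b : ℝ) (ha0 : 0 < a) (ha1 : a ≤ 1) (hb0 : 0 < b) (hb1 : b ≤ 1)
    (A B : ℕ → Fin n → Fin n → ℝ)
    (hA0 : ∀ k i j, 0 ≤ A k i j) (hArow : ∀ k i, ∑ j, A k i j = 1)
    (hAdiag : ∀ k i, 0 < A k i i) (hAa : ∀ k i j, A k i j ≠ 0 → a ≤ A k i j)
    (hB0 : ∀ k i j, 0 ≤ B k i j) (hBcol : ∀ k j, ∑ i, B k i j = 1)
    (hBdiag : ∀ k i, 0 < B k i i) (hBb : ∀ k i j, B k i j ≠ 0 → b ≤ B k i j)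
    (av bv : ℕ → Fin n → ℝ)
    (hav0 : ∀ k i, 0 ≤ av k i) (hav1 : ∀ k, ∑ i, av k i = 1)
    (hbv0 : ∀ k i, 0 ≤ bv k i) (hbv1 : ∀ k, ∑ i, bv k i = 1)
    (havrec : ∀ k j, av (k+1) j = ∑ i, av k i * A k i j)
    (hbvrec : ∀ k i, bv (k+1) i = ∑ j, B k i j * bv k j)
    (havlb : ∀ k i, a ^ n / (n : ℝ) ≤ av k i)
    (hbvlb : ∀ k i, b ^ n / (n : ℝ) ≤ bv k i)
    (ηx ηy ηz : ℕ → ℝ) (hηx : ∀ k, 0 < ηx k) (hηy : ∀ k, 0 < ηy k) (hηz : ∀ k, 0 < ηz k)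
    (xv : ℕ → Fin n → Euc dx) (yv zv : ℕ → Fin n → Euc dy)
    (tX : ℕ → Fin n → Euc dx) (tY tZ : ℕ → Fin n → Euc dy)
    (dX : ℕ → Fin n → Euc dx) (dY dZ : ℕ → Fin n → Euc dy)
    (hdX : ∀ k i, dX k i = gradX (f i) (xv k i) (yv k i)
        + lam • (gradX (g i) (xv k i) (yv k i) - gradX (g i) (xv k i) (zv k i)))
    (hdY : ∀ k i, dY k i = gradY (f i) (xv k i) (yv k i) + lam • gradY (g i) (xv k i) (yv k i))
    (hdZ : ∀ k i, dZ k i = lam • gradY (g i) (xv k i) (zv k i))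
    (hxup : ∀ k i, xv (k+1) i = (∑ j, A k i j • xv k j) - ηx k • tX k i)
    (hyup : ∀ k i, yv (k+1) i = (∑ j, A k i j • yv k j) - ηy k • tY k i)
    (hzup : ∀ k i, zv (k+1) i = (∑ j, A k i j • zv k j) - ηz k • tZ k i)
    (htXup : ∀ k i, tX (k+1) i = (∑ j, B k i j • tX k j) + dX (k+1) i - dX k i)
    (htYup : ∀ k i, tY (k+1) i = (∑ j, B k i j • tY k j) + dY (k+1) i - dY k i)
    (htZup : ∀ k i, tZ (k+1) i = (∑ j, B k i j • tZ k j) + dZ (k+1) i - dZ k i)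
    (htX0 : ∀ i, tX 0 i = dX 0 i) (htY0 : ∀ i, tY 0 i = dY 0 i) (htZ0 : ∀ i, tZ 0 i = dZ 0 i)
    (xhat : ℕ → Euc dx) (yhat zhat : ℕ → Euc dy)
    (hxhat : ∀ k, xhat k = ∑ i, av k i • xv k i)
    (hyhat : ∀ k, yhat k = ∑ i, av k i • yv k i)
    (hzhat : ∀ k, zhat k = ∑ i, av k i • zv k i)
    (hxhatdyn : ∀ k, xhat (k+1) = xhat k - ηx k • ∑ i, av (k+1) i • tX k i)
    (hyhatdyn : ∀ k, yhat (k+1) = yhat k - ηy k • ∑ i, av (k+1) i • tY k i)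
    (hzhatdyn : ∀ k, zhat (k+1) = zhat k - ηz k • ∑ i, av (k+1) i • tZ k i)
    (VD : ℕ → ℝ)
    (hVD : ∀ k, VD k = consD (av k) (xv k) + consD (av k) (yv k) + consD (av k) (zv k))
    (Lstar1 : ℝ)
    (hLsmooth : ∀ u v : Euc dx, ‖gradient Lstar u - gradient Lstar v‖ ≤ Lstar1 * ‖u - v‖)
    (hlam : 2 * Lf1 / μ ≤ lam) :
    ∀ k : ℕ,
      Lstar (xhat (k+1)) - Lstar (xhat k) ≤
        -(1 / (2 * ηx k * (∑ i, av (k+1) i * ((n : ℝ) * bv k i)))) * ‖xhat (k+1) - xhat k‖ ^ 2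
        + (Lstar1 / 2) * ‖xhat (k+1) - xhat k‖ ^ 2
        + (ηx k / (2 * (∑ i, av (k+1) i * ((n : ℝ) * bv k i)))) *
            (3 * lam ^ 2 * Lg1 ^ 2 * ((n : ℝ) ^ 2 * (⨆ i, av (k+1) i) ^ 2) * ‖zhat k - ystar (xhat k)‖ ^ 2
              + 6 * (Lf1 ^ 2 + lam ^ 2 * Lg1 ^ 2) * ((n : ℝ) ^ 2 * (⨆ i, av (k+1) i) ^ 2) * ‖yhat k - ystarl (xhat k)‖ ^ 2
              + 6 * trackS (bv k) (tX k)
              + (6 * Lf1 ^ 2 + 12 * lam ^ 2 * Lg1 ^ 2) * ((n : ℝ) / (⨅ i, av k i)) * VD k)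
        - (ηx k / 2) * (∑ i, av (k+1) i * ((n : ℝ) * bv k i)) * ‖gradient Lstar (xhat k)‖ ^ 2 := by
  intro k
  have : Nonempty (Fin n) := ⟨⟨0, hn⟩⟩
  have hn' : (0 : ℝ) < n := by exact_mod_cast hn
  have hav : ∀ k i, 0 < av k i := fun k i => lt_of_lt_of_le (by positivity) (havlb k i)
  have hbv : ∀ k i, 0 < bv k i := fun k i => lt_of_lt_of_le (by positivity) (hbvlb k i)
  have hf : ∀ i, Differentiable ℝ (f i) := fun i => (hfC2 i).differentiable (by norm_num)
  have hg : ∀ i, Differentiable ℝ (g i) := fun i => (hgC2 i).differentiable (by norm_num)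
  have hgmono : ∀ i x y y', μ * ‖y - y'‖ ^ 2
      ≤ (fderiv ℝ (g i) (x, y) - fderiv ℝ (g i) (x, y')) (0, y - y') := fun i x y y' => by
    simpa using (hgSC i x).mul_norm_sq_le_fderiv_sub
      (φ' := fun y => (fderiv ℝ (g i) (x, y)).comp (ContinuousLinearMap.inr ℝ _ _))
      (fun y => (hg i (x, y)).hasFDerivAt.comp y (hasFDerivAt_prodMk_right x y)) y y'
  have hbound : ∀ (h : Euc dx × Euc dy → ℝ) (L : ℝ),
      (∀ p q, ‖fderiv ℝ h p - fderiv ℝ h q‖ ≤ L * ‖p - q‖) → ∀ x y y',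
      |(fderiv ℝ h (x, y) - fderiv ℝ h (x, y')) (0, y - y')| ≤ L * ‖y - y'‖ ^ 2 := by
    intro h L hL x y y'
    have h1 := (fderiv ℝ h (x, y) - fderiv ℝ h (x, y')).le_opNorm (0, y - y')
    have h2 := hL (x, y) (x, y')
    rw [Prod.mk_sub_mk, Prod.norm_mk, sub_self, norm_zero, max_eq_right (norm_nonneg _)] at h2
    rw [Prod.norm_mk, norm_zero, max_eq_right (norm_nonneg _)] at h1
    rw [Real.norm_eq_abs] at h1
    nlinarith [mul_le_mul_of_nonneg_right h2 (norm_nonneg (y - y'))]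
  obtain ⟨i₀⟩ := this
  have : Nonempty (Fin dy) := ⟨⟨0, hdy⟩⟩
  obtain ⟨y₀, hy₀⟩ := exists_ne (0 : Euc dy)
  have hy₀' : 0 < ‖y₀ - 0‖ ^ 2 := by rw [sub_zero]; have := norm_pos_iff.2 hy₀; positivity
  have hP : 0 ≤ Lf1 :=
    nonneg_of_mul_nonneg_left ((abs_nonneg _).trans (hbound _ _ (hfSmooth i₀) 0 y₀ 0)) hy₀'
  have hμL : μ ≤ Lg1 := le_of_mul_le_mul_right ((hgmono i₀ 0 y₀ 0).trans
    ((le_abs_self _).trans (hbound _ _ (hgSmooth i₀) 0 y₀ 0))) hy₀'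
  have hlam' : 2 * Lf1 ≤ lam * μ := (div_le_iff₀ hμ).1 hlam
  have hPQ : 2 * Lf1 ≤ lam * Lg1 := hlam'.trans (mul_le_mul_of_nonneg_left hμL hlam0.le)
  have hL0 : 0 < Lg1 := hμ.trans_le hμL
  have hQ : 0 < lam * Lg1 := mul_pos hlam0 hL0
  -- the gradient of `Lstar`
  have hφd : ∀ i p, fderiv ℝ (fun p => f i p + lam * g i p) p
      = fderiv ℝ (f i) p + lam • fderiv ℝ (g i) p := fun i p => by
    rw [fderiv_fun_add (hf i p) ((hg i p).const_mul lam), fderiv_const_mul (hg i p)]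
  have hφsub : ∀ i p q, fderiv ℝ (fun p => f i p + lam * g i p) p
      - fderiv ℝ (fun p => f i p + lam * g i p) q
      = (fderiv ℝ (f i) p - fderiv ℝ (f i) q)
        + lam • (fderiv ℝ (g i) p - fderiv ℝ (g i) q) := fun i p q => by
    rw [hφd, hφd]; module
  set D : Euc dx → Fin n → Euc dx := fun x i => gradX (f i) x (ystarl x)
    + lam • (gradX (g i) x (ystarl x) - gradX (g i) x (ystar x)) with hD
  have hgrad : ∀ x, HasGradientAt Lstar ((1 / (n : ℝ)) • ∑ i, D x i) x := by
    intro x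
    have h1 := hasGradientAt_average_min hn hμ hg hgSmooth hgmono hGb hystar x
    have h2 := hasGradientAt_average_min (M := Lf1 + lam * Lg1) (m := lam * μ - Lf1) hn
      (by nlinarith [mul_pos hlam0 hμ]) (fun i => (hf i).fun_add ((hg i).const_mul lam))
      (fun i p q => by
        rw [hφsub]
        refine (norm_add_le _ _).trans ?_
        rw [norm_smul, Real.norm_of_nonneg hlam0.le]
        nlinarith [hfSmooth i p q, mul_le_mul_of_nonneg_left (hgSmooth i p q) hlam0.le])
      (fun i x y y' => by
        rw [hφsub, _root_.add_apply, _root_.smul_apply, smul_eq_mul]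
        nlinarith [neg_le_of_abs_le (hbound _ _ (hfSmooth i) x y y'),
          mul_le_mul_of_nonneg_left (hgmono i x y y') hlam0.le])
      (Φ := fun p => Fb p + lam * Gb p)
      (fun p => by
        rw [hFb, hGb, Finset.sum_add_distrib, ← Finset.mul_sum]; ring)
      hystarl x
    rw [hasGradientAt_iff_hasFDerivAt] at h1 h2 ⊢
    have h3 : Lstar = fun x => (Fb (x, ystarl x) + lam * Gb (x, ystarl x))
        - lam * Gb (x, ystar x) := by
      funext x; rw [hLstar]; ring
    rw [h3]
    refine (h2.sub (h1.const_mul lam)).congr_fderiv ?_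
    rw [← map_smul, ← map_sub]
    congr 1
    rw [smul_comm lam, ← smul_sub, Finset.smul_sum, ← Finset.sum_sub_distrib]
    congr 1
    refine Finset.sum_congr rfl fun i _ => ?_
    rw [gradX_add_smul (hf i) (hg i), hD]
    module
  have hdesc := le_add_inner_gradient_add_sq (fun x => (hgrad x).differentiableAt) hLsmooth
    (xhat k) (xhat (k + 1))
  -- the error of the search direction
  set c := ∑ i, av (k + 1) i * bv k i with hc
  set m := ⨆ i, av (k + 1) i with hm
  have hW : ∑ i, av (k + 1) i * ((n : ℝ) * bv k i) = n * c := by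
    rw [hc, Finset.mul_sum]; exact Finset.sum_congr rfl fun i _ => by ring
  have hav_le : ∀ i, av (k + 1) i ≤ 1 := fun i => by
    rw [← hav1 (k + 1)]
    exact Finset.single_le_sum (fun j _ => hav0 (k + 1) j) (Finset.mem_univ i)
  have hc0 : 0 < c := Finset.sum_pos (fun i _ => mul_pos (hav _ i) (hbv _ i)) ⟨i₀, Finset.mem_univ _⟩
  have hcm : c ≤ m := by
    rw [← mul_one m, ← hbv1 k, Finset.mul_sum]
    exact Finset.sum_le_sum fun i _ => mul_le_mul_of_nonneg_right
      (le_ciSup (Set.finite_range _).bddAbove i) (hbv0 k i)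
  have hc1 : c ≤ 1 := by
    rw [← hbv1 k]
    exact Finset.sum_le_sum fun i _ => mul_le_of_le_one_left (hbv0 k i) (hav_le i)
  have hm0 : 0 < m := hc0.trans_le hcm
  set s := ∑ i, av (k + 1) i • tX k i with hs
  set T := ∑ i, tX k i with hT
  have hTd : T = ∑ i, dX k i := sum_tracker_eq hBcol htXup htX0 k
  set X := xhat k with hX
  set R : Fin n → ℝ := fun i => ‖xv k i - xhat k‖ ^ 2 + ‖yv k i - yhat k‖ ^ 2
    + ‖zv k i - zhat k‖ ^ 2 with hR
  have hVDR : ∑ i, av k i * R i = VD k := by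
    rw [hVD, consD, consD, consD, ← hxhat, ← hyhat, ← hzhat, ← Finset.sum_add_distrib,
      ← Finset.sum_add_distrib]
    exact Finset.sum_congr rfl fun i _ => by rw [hR]; ring
  have hR0 : ∀ i, 0 ≤ R i := fun i => by positivity
  set d : Fin n → Euc dx := fun i => gradX (f i) X (yhat k)
    + lam • (gradX (g i) X (yhat k) - gradX (g i) X (zhat k)) with hd
  set Y : Fin n → Euc dx := fun i => (gradX (f i) X (yhat k) - gradX (f i) X (ystarl X))
    + lam • (gradX (g i) X (yhat k) - gradX (g i) X (ystarl X)) with hY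
  set Z : Fin n → Euc dx := fun i =>
    lam • (gradX (g i) X (zhat k) - gradX (g i) X (ystar X)) with hZ
  have hsplit : s - (n * c) • gradient Lstar X = (s - c • T) + c • ∑ i, (dX k i - d i)
      + c • ∑ i, Y i - c • ∑ i, Z i := by
    have e1 : ∀ i, D X i = d i - Y i + Z i := fun i => by
      simp only [hD, hd, hY, hZ]; module
    rw [(hgrad X).gradient, smul_smul, Finset.sum_congr rfl fun i _ => e1 i,
      Finset.sum_add_distrib, Finset.sum_sub_distrib, Finset.sum_sub_distrib, hTd]
    have : (n : ℝ) * c * (1 / n) = c := by field_simp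
    rw [this]
    module
  have hcons : ∀ i, ‖dX k i - d i‖ ^ 2 ≤ (Lf1 + 2 * (lam * Lg1)) ^ 2 * R i := by
    intro i
    have e : dX k i - d i = (gradX (f i) (xv k i) (yv k i) - gradX (f i) X (yhat k))
        + lam • (gradX (g i) (xv k i) (yv k i) - gradX (g i) X (yhat k))
        - lam • (gradX (g i) (xv k i) (zv k i) - gradX (g i) X (zhat k)) := by
      rw [hdX, hd]; module
    have hxR : ‖xv k i - X‖ ≤ √(R i) := Real.le_sqrt_of_sq_le (by
      simp only [hR]; nlinarith [sq_nonneg ‖yv k i - yhat k‖, sq_nonneg ‖zv k i - zhat k‖])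
    have hyR : ‖yv k i - yhat k‖ ≤ √(R i) := Real.le_sqrt_of_sq_le (by
      simp only [hR]; nlinarith [sq_nonneg ‖xv k i - X‖, sq_nonneg ‖zv k i - zhat k‖])
    have hzR : ‖zv k i - zhat k‖ ≤ √(R i) := Real.le_sqrt_of_sq_le (by
      simp only [hR]; nlinarith [sq_nonneg ‖yv k i - yhat k‖, sq_nonneg ‖xv k i - X‖])
    have h1 : ‖dX k i - d i‖ ≤ (Lf1 + 2 * (lam * Lg1)) * √(R i) := by
      rw [e]
      refine (norm_sub_le _ _).trans ((add_le_add_left (norm_add_le _ _) _).trans ?_)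
      rw [norm_smul, norm_smul, Real.norm_of_nonneg hlam0.le]
      have g1 := (norm_gradX_sub_le (hf i) (hfSmooth i) (xv k i) X (yv k i) (yhat k)).trans
        (mul_le_mul_of_nonneg_left (max_le hxR hyR) hP)
      have g2 := (norm_gradX_sub_le (hg i) (hgSmooth i) (xv k i) X (yv k i) (yhat k)).trans
        (mul_le_mul_of_nonneg_left (max_le hxR hyR) hL0.le)
      have g3 := (norm_gradX_sub_le (hg i) (hgSmooth i) (xv k i) X (zv k i) (zhat k)).trans
        (mul_le_mul_of_nonneg_left (max_le hxR hzR) hL0.le)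
      nlinarith [mul_le_mul_of_nonneg_left g2 hlam0.le, mul_le_mul_of_nonneg_left g3 hlam0.le]
    calc ‖dX k i - d i‖ ^ 2 ≤ ((Lf1 + 2 * (lam * Lg1)) * √(R i)) ^ 2 := by gcongr
      _ = _ := by rw [mul_pow, Real.sq_sqrt (hR0 i)]
  set K := (n : ℝ) / (⨅ i, av k i) * VD k with hK
  have hK0 : 0 ≤ K := by
    have h1 : 0 ≤ ⨅ i, av k i := Real.iInf_nonneg (hav0 k)
    have h2 : 0 ≤ VD k := by
      rw [← hVDR]; exact Finset.sum_nonneg fun i _ => mul_nonneg (hav0 k i) (hR0 i)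
    positivity
  have hCn : ‖c • ∑ i, (dX k i - d i)‖ ≤ (Lf1 + 2 * (lam * Lg1)) * √K := by
    have h1 := norm_sum_sq_le_of_weights hn (hav k) hR0 hcons
    rw [hVDR, ← hK] at h1
    have h2 : ‖∑ i, (dX k i - d i)‖ ≤ (Lf1 + 2 * (lam * Lg1)) * √K := by
      refine le_of_sq_le_sq ?_ (by positivity)
      rwa [mul_pow, Real.sq_sqrt hK0]
    rw [norm_smul, Real.norm_of_nonneg hc0.le]
    exact (mul_le_of_le_one_left (norm_nonneg _) hc1).trans h2
  have hsum : ∀ (v : Fin n → Euc dx) (r : ℝ), 0 ≤ r → (∀ i, ‖v i‖ ≤ r) →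
      ‖c • ∑ i, v i‖ ≤ n * m * r := by
    intro v r hr hv
    rw [norm_smul, Real.norm_of_nonneg hc0.le]
    have h1 : ‖∑ i, v i‖ ≤ n * r := by
      simpa using norm_sum_le_of_le Finset.univ fun i _ => hv i
    calc c * ‖∑ i, v i‖ ≤ m * (n * r) := by gcongr
      _ = _ := by ring
  have hYn : ‖c • ∑ i, Y i‖ ≤ (Lf1 + lam * Lg1) * (n * m * ‖yhat k - ystarl X‖) := by
    refine (hsum Y ((Lf1 + lam * Lg1) * ‖yhat k - ystarl X‖) (by positivity) fun i => ?_).trans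
      (by ring_nf; rfl)
    refine (norm_add_le _ _).trans ?_
    rw [norm_smul, Real.norm_of_nonneg hlam0.le]
    have g1 := norm_gradX_sub_le (hf i) (hfSmooth i) X X (yhat k) (ystarl X)
    have g2 := norm_gradX_sub_le (hg i) (hgSmooth i) X X (yhat k) (ystarl X)
    rw [sub_self, norm_zero, max_eq_right (norm_nonneg _)] at g1 g2
    nlinarith [mul_le_mul_of_nonneg_left g2 hlam0.le]
  have hZn : ‖c • ∑ i, Z i‖
      ≤ (lam * Lg1 - 2 * Lf1) * (n * m * ‖zhat k - ystar X‖) := by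
    refine (hsum Z ((lam * Lg1 - 2 * Lf1) * ‖zhat k - ystar X‖)
      (mul_nonneg (by linarith) (norm_nonneg _)) fun i => ?_).trans (by ring_nf; rfl)
    rw [hZ, norm_smul, Real.norm_of_nonneg hlam0.le]
    have g1 := norm_gradX_sub_le_of_strongConvex (hg i) hμL (hgSmooth i) X (zhat k) (ystar X)
      (hgmono i _ _ _)
    nlinarith [mul_le_mul_of_nonneg_left g1 hlam0.le,
      mul_le_mul_of_nonneg_right hlam' (norm_nonneg (zhat k - ystar X))]
  have hSn : ‖s - c • T‖ ≤ √(trackS (bv k) (tX k)) :=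
    Real.le_sqrt_of_sq_le
      (norm_sum_smul_sub_sq_le_trackS (hav0 (k + 1)) hav_le (hbv k) (hbv1 k) (tX k))
  have hS0 : 0 ≤ trackS (bv k) (tX k) :=
    Finset.sum_nonneg fun i _ => mul_nonneg (hbv0 k i) (sq_nonneg _)
  have herr : ‖s - (n * c) • gradient Lstar X‖ ^ 2
      ≤ 3 * lam ^ 2 * Lg1 ^ 2 * ((n : ℝ) ^ 2 * m ^ 2) * ‖zhat k - ystar X‖ ^ 2
        + 6 * (Lf1 ^ 2 + lam ^ 2 * Lg1 ^ 2) * ((n : ℝ) ^ 2 * m ^ 2) * ‖yhat k - ystarl X‖ ^ 2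
        + 6 * trackS (bv k) (tX k)
        + (6 * Lf1 ^ 2 + 12 * lam ^ 2 * Lg1 ^ 2) * ((n : ℝ) / (⨅ i, av k i)) * VD k := by
    have h1 : ‖s - (n * c) • gradient Lstar X‖ ≤ √(trackS (bv k) (tX k))
        + (Lf1 + 2 * (lam * Lg1)) * √K + (Lf1 + lam * Lg1) * (n * m * ‖yhat k - ystarl X‖)
        + (lam * Lg1 - 2 * Lf1) * (n * m * ‖zhat k - ystar X‖) := by
      rw [hsplit]
      refine (norm_sub_le _ _).trans (add_le_add ((norm_add_le _ _).trans
        (add_le_add ((norm_add_le _ _).trans (add_le_add hSn hCn)) hYn)) hZn)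
    refine (pow_le_pow_left₀ (norm_nonneg _) h1 2).trans ((sq_add_four_le hP hPQ hQ).trans ?_)
    rw [Real.sq_sqrt hS0, Real.sq_sqrt hK0, hK]
    exact le_of_eq (by ring)
  -- polarization of the inner product in the descent inequality
  have hη := hηx k
  have hstep : xhat (k + 1) - X = -(ηx k • s) := by rw [hxhatdyn, ← hX]; abel
  have hpol : ⟪gradient Lstar X, xhat (k + 1) - X⟫
      = -(1 / (2 * ηx k * (n * c))) * ‖xhat (k + 1) - X‖ ^ 2
        + ηx k / (2 * (n * c)) * ‖s - (n * c) • gradient Lstar X‖ ^ 2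
        - ηx k / 2 * (n * c) * ‖gradient Lstar X‖ ^ 2 := by
    rw [hstep, inner_neg_right, inner_smul_right, norm_neg, norm_smul,
      Real.norm_of_nonneg hη.le, norm_sub_sq_real, norm_smul, inner_smul_right,
      Real.norm_of_nonneg (by positivity), real_inner_comm]
    field_simp
    ring
  rw [hW]
  have hfin := mul_le_mul_of_nonneg_left herr (show 0 ≤ ηx k / (2 * (n * c)) by positivity)
  rw [hpol] at hdesc
  linarith
end
end

section
/- For every k ≥ 0 the Push–Pull iterates satisfy ‖∑_{i=1}^n ∇f_i(x_i^k)‖² ≤ 12L_{f,1}²(n/min_i[α_k]_i) D(x^k, α_k) + 4n² ‖∇F(x̂^k)‖². -/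
open scoped BigOperators RealInnerProductSpace

set_option linter.unusedVariables false

noncomputable section

theorem norm_sum_sq_le_card_mul_sum_norm_sq {ι V : Type*} [Fintype ι]
    [SeminormedAddCommGroup V] (v : ι → V) :
    ‖∑ i, v i‖ ^ 2 ≤ (Fintype.card ι : ℝ) * ∑ i, ‖v i‖ ^ 2 :=
  (pow_le_pow_left₀ (norm_nonneg _) (norm_sum_le _ _) 2).trans sq_sum_le_card_mul_sum_sq

theorem norm_add_sq_le_two_mul {V : Type*} [SeminormedAddCommGroup V] (u v : V) :
    ‖u + v‖ ^ 2 ≤ 2 * (‖u‖ ^ 2 + ‖v‖ ^ 2) :=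
  (pow_le_pow_left₀ (norm_nonneg _) (norm_add_le _ _) 2).trans add_sq_le

theorem gradient_const_mul_sum {ι V : Type*} [Fintype ι] [NormedAddCommGroup V]
    [InnerProductSpace ℝ V] [CompleteSpace V] {f : ι → V → ℝ} {p : V}
    (hf : ∀ i, DifferentiableAt ℝ (f i) p) (c : ℝ) :
    gradient (fun q => c * ∑ i, f i q) p = c • ∑ i, gradient (f i) p := by
  have h : HasFDerivAt (fun q => c * ∑ i, f i q) (c • ∑ i, fderiv ℝ (f i) p) p :=
    (HasFDerivAt.fun_sum fun i _ => (hf i).hasFDerivAt).const_mul c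
  rw [gradient, h.fderiv, map_smulₛₗ, map_sum]
  simp [gradient]

theorem iInf_pos_of_finite {ι : Type*} [Finite ι] [Nonempty ι] {w : ι → ℝ}
    (hw : ∀ i, 0 < w i) : 0 < ⨅ i, w i := by
  obtain ⟨i, hi⟩ := exists_eq_ciInf_of_finite (f := w)
  exact hi ▸ hw i

theorem iInf_mul_sum_norm_sq_le_consD {n : ℕ} {V : Type*} [NormedAddCommGroup V]
    [NormedSpace ℝ V] (w : Fin n → ℝ) (v : Fin n → V) :
    (⨅ i, w i) * ∑ i, ‖v i - ∑ j, w j • v j‖ ^ 2 ≤ consD w v := by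
  rw [consD, Finset.mul_sum]
  gcongr with i
  exact ciInf_le (Set.finite_range w).bddBelow i

theorem consD_nonneg {n : ℕ} {V : Type*} [NormedAddCommGroup V] [NormedSpace ℝ V]
    {w : Fin n → ℝ} (hw : ∀ i, 0 ≤ w i) (v : Fin n → V) : 0 ≤ consD w v :=
  Finset.sum_nonneg fun i _ => mul_nonneg (hw i) (sq_nonneg _)

theorem norm_sum_sub_sq_le_consD {n : ℕ} {V W : Type*} [NormedAddCommGroup V] [NormedSpace ℝ V]
    [SeminormedAddCommGroup W] {g : Fin n → V → W} {L : ℝ}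
    (hg : ∀ i p q, ‖g i p - g i q‖ ≤ L * ‖p - q‖)
    {w : Fin n → ℝ} (hw : 0 < ⨅ i, w i) (v : Fin n → V) :
    ‖∑ i, (g i (v i) - g i (∑ j, w j • v j))‖ ^ 2 ≤
      L ^ 2 * ((n : ℝ) / ⨅ i, w i) * consD w v := by
  set m := ∑ j, w j • v j
  calc ‖∑ i, (g i (v i) - g i m)‖ ^ 2
      ≤ n * ∑ i, ‖g i (v i) - g i m‖ ^ 2 := by
        simpa using norm_sum_sq_le_card_mul_sum_norm_sq fun i => g i (v i) - g i m
    _ ≤ n * ∑ i, (L * ‖v i - m‖) ^ 2 := by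
        gcongr with i
        exact hg i _ _
    _ = L ^ 2 * n * ∑ i, ‖v i - m‖ ^ 2 := by
        simp only [mul_pow, ← Finset.mul_sum]
        ring
    _ ≤ L ^ 2 * n * (consD w v / ⨅ i, w i) := by
        gcongr
        rw [le_div_iff₀' hw]
        exact iInf_mul_sum_norm_sq_le_consD w v
    _ = L ^ 2 * ((n : ℝ) / ⨅ i, w i) * consD w v := by ring

theorem stmt14
    (d n : ℕ) (hd : 0 < d) (hn : 0 < n)
    (f : Fin n → Euc d → ℝ) (Fb : Euc d → ℝ)
    (hFb : ∀ p, Fb p = (1 / (n : ℝ)) * ∑ i, f i p)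
    (Lf1 : ℝ)
    (hfC1 : ∀ i, ContDiff ℝ 1 (f i))
    (hfSmooth : ∀ i p q, ‖gradient (f i) p - gradient (f i) q‖ ≤ Lf1 * ‖p - q‖)
    (a b : ℝ) (ha0 : 0 < a) (ha1 : a ≤ 1) (hb0 : 0 < b) (hb1 : b ≤ 1)
    (A B : ℕ → Fin n → Fin n → ℝ)
    (hA0 : ∀ k i j, 0 ≤ A k i j) (hArow : ∀ k i, ∑ j, A k i j = 1)
    (hAdiag : ∀ k i, 0 < A k i i) (hAa : ∀ k i j, A k i j ≠ 0 → a ≤ A k i j)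
    (hB0 : ∀ k i j, 0 ≤ B k i j) (hBcol : ∀ k j, ∑ i, B k i j = 1)
    (hBdiag : ∀ k i, 0 < B k i i) (hBb : ∀ k i j, B k i j ≠ 0 → b ≤ B k i j)
    (av bv : ℕ → Fin n → ℝ)
    (hav0 : ∀ k i, 0 ≤ av k i) (hav1 : ∀ k, ∑ i, av k i = 1)
    (hbv0 : ∀ k i, 0 ≤ bv k i) (hbv1 : ∀ k, ∑ i, bv k i = 1)
    (havrec : ∀ k j, av (k+1) j = ∑ i, av k i * A k i j)
    (hbvrec : ∀ k i, bv (k+1) i = ∑ j, B k i j * bv k j)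
    (havlb : ∀ k i, a ^ n / (n : ℝ) ≤ av k i)
    (hbvlb : ∀ k i, b ^ n / (n : ℝ) ≤ bv k i)
    (η : ℕ → ℝ) (hη : ∀ k, 0 < η k)
    (xv : ℕ → Fin n → Euc d) (t : ℕ → Fin n → Euc d)
    (hxup : ∀ k i, xv (k+1) i = (∑ j, A k i j • xv k j) - η k • t k i)
    (htup : ∀ k i, t (k+1) i = (∑ j, B k i j • t k j) + gradient (f i) (xv (k+1) i) - gradient (f i) (xv k i))
    (ht0 : ∀ i, t 0 i = gradient (f i) (xv 0 i))
    (xhat : ℕ → Euc d) (hxhat : ∀ k, xhat k = ∑ i, av k i • xv k i) :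
    ∀ k : ℕ,
      ‖∑ i, gradient (f i) (xv k i)‖ ^ 2 ≤
        12 * Lf1 ^ 2 * ((n : ℝ) / (⨅ i, av k i)) * consD (av k) (xv k)
        + 4 * (n : ℝ) ^ 2 * ‖gradient Fb (xhat k)‖ ^ 2 := by
  intro k
  have hn' : (0 : ℝ) < n := Nat.cast_pos.2 hn
  have : Nonempty (Fin n) := ⟨⟨0, hn⟩⟩
  have hmin : 0 < ⨅ i, av k i :=
    iInf_pos_of_finite fun i => (div_pos (pow_pos ha0 n) hn').trans_le (havlb k i)
  have hgrad : ∑ i, gradient (f i) (xhat k) = (n : ℝ) • gradient Fb (xhat k) := by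
    rw [funext hFb, gradient_const_mul_sum fun i => (hfC1 i).differentiable one_ne_zero _,
      smul_smul, mul_one_div_cancel hn'.ne', one_smul]
  have hsplit : ∑ i, gradient (f i) (xv k i) =
      ∑ i, (gradient (f i) (xv k i) - gradient (f i) (xhat k)) +
        (n : ℝ) • gradient Fb (xhat k) := by
    rw [← hgrad, Finset.sum_sub_distrib, sub_add_cancel]
  have hdev := norm_sum_sub_sq_le_consD hfSmooth hmin (xv k)
  rw [← hxhat] at hdev
  have hD : 0 ≤ Lf1 ^ 2 * ((n : ℝ) / ⨅ i, av k i) * consD (av k) (xv k) :=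
    mul_nonneg (by positivity) (consD_nonneg (hav0 k) _)
  have hF : 0 ≤ (n : ℝ) ^ 2 * ‖gradient Fb (xhat k)‖ ^ 2 := by positivity
  have hadd := norm_add_sq_le_two_mul
    (∑ i, (gradient (f i) (xv k i) - gradient (f i) (xhat k))) ((n : ℝ) • gradient Fb (xhat k))
  rw [← hsplit, norm_smul, Real.norm_natCast, mul_pow] at hadd
  linarith
end
end

section
/- Let {A^k}_{k≥0} be a sequence of nonnegative n×n row-stochastic matrices, each with positive diagonal entries, all of whose nonzero entries are at least a ∈ (0,1], and each compatible with a strongly connected directed graph on n nodes (the directed graph with an edge between distinct nodes i and j whenever A^k_{ij} > 0 is strongly connected). Then there exists a sequence {α_k}_{k≥0} of stochastic vectors in ℝ^n (nonnegative entries summing to 1) such that α_{k+1}ᵀ = α_kᵀ A^k for all k ≥ 0 and [α_{k+1}]_i ≥ aⁿ/n for all i ∈ {1,…,n} and all k ≥ 0. -/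
open scoped BigOperators RealInnerProductSpace

set_option linter.unusedVariables false

noncomputable section

/-- A path leaving a set contains an edge leaving it. -/
lemma Relation.TransGen.exists_crossing {α : Type*} {r : α → α → Prop} {S : Set α} {i j : α}
    (h : Relation.TransGen r i j) (hi : i ∈ S) (hj : j ∉ S) :
    ∃ p ∈ S, ∃ q ∉ S, r p q := by
  induction h with
  | single h => exact ⟨i, hi, _, hj, h⟩
  | @tail b c _ hbc ih =>
    by_cases hb : b ∈ S
    · exact ⟨b, hb, c, hj, hbc⟩
    · exact ih hb

/-- The trajectory of a row vector under right multiplication by successive matrices. -/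
def rowTrajectory {n : ℕ} (A : ℕ → Fin n → Fin n → ℝ) (v : Fin n → ℝ) : ℕ → Fin n → ℝ
  | 0 => v
  | k + 1 => fun j => ∑ i, rowTrajectory A v k i * A k i j

section

variable {n : ℕ} {a : ℝ} {A : ℕ → Fin n → Fin n → ℝ} {v : ℕ → Fin n → ℝ}

lemma mul_le_step (hA0 : ∀ k i j, 0 ≤ A k i j)
    (hAa : ∀ k i j, A k i j ≠ 0 → a ≤ A k i j)
    (hv0 : ∀ k i, 0 ≤ v k i) (hv : ∀ k j, v (k + 1) j = ∑ i, v k i * A k i j)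
    {k : ℕ} {p q : Fin n} (hpq : 0 < A k p q) : v k p * a ≤ v (k + 1) q := by
  rw [hv]
  exact (mul_le_mul_of_nonneg_left (hAa k p q hpq.ne') (hv0 k p)).trans
    (Finset.single_le_sum (f := fun i => v k i * A k i q)
      (fun i _ => mul_nonneg (hv0 k i) (hA0 k i q)) (Finset.mem_univ p))

lemma mul_pow_le_add_steps (ha0 : 0 ≤ a) (hA0 : ∀ k i j, 0 ≤ A k i j)
    (hAdiag : ∀ k i, 0 < A k i i) (hAa : ∀ k i j, A k i j ≠ 0 → a ≤ A k i j)
    (hv0 : ∀ k i, 0 ≤ v k i) (hv : ∀ k j, v (k + 1) j = ∑ i, v k i * A k i j)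
    (k m : ℕ) (i : Fin n) : v k i * a ^ m ≤ v (k + m) i := by
  induction m with
  | zero => simp
  | succ m ih =>
    rw [pow_succ, ← mul_assoc]
    exact (mul_le_mul_of_nonneg_right ih ha0).trans
      (mul_le_step hA0 hAa hv0 hv (hAdiag (k + m) i))

/-- The set of nodes receiving a definite share of the mass of node `i` gains a node per step. -/
lemma exists_finset_card_le_of_steps (ha0 : 0 ≤ a) (hA0 : ∀ k i j, 0 ≤ A k i j)
    (hAdiag : ∀ k i, 0 < A k i i) (hAa : ∀ k i j, A k i j ≠ 0 → a ≤ A k i j)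
    (hconn : ∀ k, ∀ i j : Fin n, i ≠ j →
      Relation.TransGen (fun p q : Fin n => p ≠ q ∧ 0 < A k p q) i j)
    (hv0 : ∀ k i, 0 ≤ v k i) (hv : ∀ k j, v (k + 1) j = ∑ i, v k i * A k i j)
    (k m : ℕ) (i : Fin n) :
    ∃ S : Finset (Fin n), i ∈ S ∧ min (m + 1) n ≤ S.card ∧
      ∀ j ∈ S, v k i * a ^ m ≤ v (k + m) j := by
  induction m with
  | zero => exact ⟨{i}, by simp, by simp, by simp⟩
  | succ m ih =>
    obtain ⟨S, hiS, hcard, hS⟩ := ih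
    have step : ∀ p ∈ S, ∀ q, 0 < A (k + m) p q → v k i * a ^ (m + 1) ≤ v (k + (m + 1)) q := by
      intro p hp q hpq
      rw [pow_succ, ← mul_assoc]
      exact (mul_le_mul_of_nonneg_right (hS p hp) ha0).trans (mul_le_step hA0 hAa hv0 hv hpq)
    by_cases hall : ∀ j, j ∈ S
    · refine ⟨S, hiS, ?_, fun j hj => step j hj j (hAdiag _ j)⟩
      simp [Finset.eq_univ_of_forall hall]
    · push Not at hall
      obtain ⟨j, hj⟩ := hall
      obtain ⟨p, hp, q, hq, -, hpq⟩ :=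
        (hconn (k + m) i j (fun h => hj (h ▸ hiS))).exists_crossing
          (S := (S : Set (Fin n))) (by simpa using hiS) (by simpa using hj)
      rw [Finset.mem_coe] at hp hq
      refine ⟨insert q S, Finset.mem_insert_of_mem hiS, ?_, ?_⟩
      · rw [Finset.card_insert_of_notMem hq]
        omega
      · intro l hl
        rcases Finset.mem_insert.1 hl with rfl | hl
        · exact step p hp l hpq
        · exact step l hl l (hAdiag _ l)

lemma mul_pow_le_of_connected (ha0 : 0 ≤ a) (hA0 : ∀ k i j, 0 ≤ A k i j)
    (hAdiag : ∀ k i, 0 < A k i i) (hAa : ∀ k i j, A k i j ≠ 0 → a ≤ A k i j)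
    (hconn : ∀ k, ∀ i j : Fin n, i ≠ j →
      Relation.TransGen (fun p q : Fin n => p ≠ q ∧ 0 < A k p q) i j)
    (hv0 : ∀ k i, 0 ≤ v k i) (hv : ∀ k j, v (k + 1) j = ∑ i, v k i * A k i j)
    (k : ℕ) (i j : Fin n) : v k i * a ^ n ≤ v (k + n) j := by
  obtain ⟨S, -, hcard, hS⟩ :=
    exists_finset_card_le_of_steps ha0 hA0 hAdiag hAa hconn hv0 hv k n i
  rw [min_eq_right n.le_succ] at hcard
  have hSu : S = Finset.univ := by
    rw [← Finset.card_eq_iff_eq_univ, Fintype.card_fin]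
    exact le_antisymm (by simpa using S.card_le_univ) hcard
  exact hS j (hSu ▸ Finset.mem_univ j)

end

theorem stmt17
    (n : ℕ) (hn : 0 < n) (a : ℝ) (ha0 : 0 < a) (ha1 : a ≤ 1)
    (A : ℕ → Fin n → Fin n → ℝ)
    (hA0 : ∀ k i j, 0 ≤ A k i j)
    (hArow : ∀ k i, ∑ j, A k i j = 1)
    (hAdiag : ∀ k i, 0 < A k i i)
    (hAa : ∀ k i j, A k i j ≠ 0 → a ≤ A k i j)
    (hconn : ∀ k, ∀ i j : Fin n, i ≠ j →
      Relation.TransGen (fun p q : Fin n => p ≠ q ∧ 0 < A k p q) i j) :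
    ∃ av : ℕ → Fin n → ℝ,
      (∀ k i, 0 ≤ av k i) ∧ (∀ k, ∑ i, av k i = 1) ∧
      (∀ k j, av (k+1) j = ∑ i, av k i * A k i j) ∧
      (∀ k i, a ^ n / (n : ℝ) ≤ av (k+1) i) := by
  have hn' : (0 : ℝ) < n := Nat.cast_pos.2 hn
  set v := rowTrajectory A (fun _ => (n : ℝ)⁻¹) with hvdef
  have hv : ∀ k j, v (k + 1) j = ∑ i, v k i * A k i j := fun k j => rfl
  have hv0 : ∀ k i, 0 ≤ v k i := by
    intro k
    induction k with
    | zero => exact fun i => inv_nonneg.2 hn'.le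
    | succ k ih => exact fun j => Finset.sum_nonneg fun i _ => mul_nonneg (ih i) (hA0 k i j)
  have hv1 : ∀ k, ∑ i, v k i = 1 := by
    intro k
    induction k with
    | zero => simp [hvdef, rowTrajectory, hn'.ne']
    | succ k ih =>
      simp_rw [hv]
      rw [Finset.sum_comm]
      simp_rw [← Finset.mul_sum, hArow, mul_one, ih]
  refine ⟨v, hv0, hv1, hv, fun k j => ?_⟩
  rw [div_eq_inv_mul]
  rcases le_total n (k + 1) with hk | hk
  · obtain ⟨l, hl⟩ := Nat.exists_eq_add_of_le' hk
    have hne : (Finset.univ : Finset (Fin n)).Nonempty := ⟨j, Finset.mem_univ j⟩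
    obtain ⟨i, -, hi⟩ := Finset.exists_le_of_sum_le (f := fun _ => (n : ℝ)⁻¹) (g := v l) hne
      (by simp [hv1, hn'.ne'])
    rw [hl]
    exact (mul_le_mul_of_nonneg_right hi (by positivity)).trans
      (mul_pow_le_of_connected ha0.le hA0 hAdiag hAa hconn hv0 hv l i j)
  · have h := mul_pow_le_add_steps ha0.le hA0 hAdiag hAa hv0 hv 0 (k + 1) j
    rw [zero_add] at h
    exact (mul_le_mul_of_nonneg_left (pow_le_pow_of_le_one ha0.le ha1 hk)
      (inv_nonneg.2 hn'.le)).trans h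
end
end

section
/- Let {B^k}_{k≥0} be a sequence of nonnegative n×n column-stochastic matrices, each with positive diagonal entries, all of whose nonzero entries are at least b ∈ (0,1], and each compatible with a strongly connected directed graph on n nodes (the directed graph with an edge between distinct nodes i and j whenever B^k_{ij} > 0 is strongly connected). Then there exists a sequence {β_k}_{k≥0} of stochastic vectors in ℝ^n (nonnegative entries summing to 1) such that β_{k+1} = B^k β_k for all k ≥ 0 and [β_{k+1}]_i ≥ bⁿ/n for all i ∈ {1,…,n} and all k ≥ 0. -/
open scoped BigOperators RealInnerProductSpace

set_option linter.unusedVariables false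

noncomputable section

/-- A path leaving the complement of `S` and ending in `S` has an edge entering `S`. -/
lemma exists_crossing_of_transGen {α : Type*} {r : α → α → Prop} {S : Set α} {a c : α}
    (h : Relation.TransGen r a c) (ha : a ∉ S) (hc : c ∈ S) :
    ∃ p ∉ S, ∃ q ∈ S, r p q := by
  by_contra! hno
  revert hc
  change c ∉ S
  induction h with
  | single hr => exact fun hq => hno _ ha _ hq hr
  | tail _ hr ih => exact fun hq => hno _ ih _ hq hr

lemma mul_le_sum_mul {ι : Type*} [Fintype ι] {a v : ι → ℝ} {b c : ℝ} {q : ι}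
    (ha : ∀ j, 0 ≤ a j) (hv : ∀ j, 0 ≤ v j) (hc : 0 ≤ c) (hb : b ≤ a q) (hq : c ≤ v q) :
    b * c ≤ ∑ j, a j * v j :=
  (mul_le_mul hb hq hc (ha q)).trans <|
    Finset.single_le_sum (f := fun j => a j * v j)
      (fun j _ => mul_nonneg (ha j) (hv j)) (Finset.mem_univ q)

/-- Multiplying by an irreducible nonnegative matrix with positive diagonal, whose nonzero entries
are at least `b`, enlarges the set of coordinates above the threshold until it is everything. -/
lemma card_superlevel_succ {ι : Type*} [Fintype ι] {A : ι → ι → ℝ} {v : ι → ℝ} {b c : ℝ} {t : ℕ}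
    (hA : ∀ i j, 0 ≤ A i j) (hdiag : ∀ i, 0 < A i i) (hb : ∀ i j, A i j ≠ 0 → b ≤ A i j)
    (hconn : ∀ i j, i ≠ j → Relation.TransGen (fun p q => p ≠ q ∧ 0 < A p q) i j)
    (hv : ∀ j, 0 ≤ v j) (hc : 0 ≤ c)
    (ht : min (t + 1) (Fintype.card ι) ≤ (Finset.univ.filter fun i => c ≤ v i).card) :
    min (t + 2) (Fintype.card ι) ≤
      (Finset.univ.filter fun i => b * c ≤ ∑ j, A i j * v j).card := by
  classical
  set S := Finset.univ.filter fun i => c ≤ v i with hS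
  set T := Finset.univ.filter fun i => b * c ≤ ∑ j, A i j * v j with hT
  have step : ∀ p q, 0 < A p q → q ∈ S → p ∈ T := fun p q hpq hq => by
    simp only [hS, hT, Finset.mem_filter, Finset.mem_univ, true_and] at hq ⊢
    exact mul_le_sum_mul (hA p) hv hc (hb p q hpq.ne') hq
  have hST : S ⊆ T := fun q hq => step q q (hdiag q) hq
  by_cases hall : S = Finset.univ
  · have := Finset.card_le_card hST
    rw [hall, Finset.card_univ] at this
    exact (min_le_right _ _).trans this
  · obtain ⟨i, hi⟩ : ∃ i, i ∉ S := by
      simpa [Finset.eq_univ_iff_forall] using hall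
    have hpos : 0 < S.card := by
      have := Fintype.card_pos_iff.mpr ⟨i⟩
      omega
    obtain ⟨j, hj⟩ := Finset.card_pos.mp hpos
    obtain ⟨p, hp, q, hq, -, hpq⟩ := exists_crossing_of_transGen (S := (S : Set ι))
      (hconn i j fun h => hi (h ▸ hj)) (by simpa using hi) (by simpa using hj)
    have hcard := Finset.card_lt_card <| Finset.ssubset_iff_of_subset hST |>.mpr
      ⟨p, step p q hpq (by simpa using hq), by simpa using hp⟩
    omega

theorem stmt18
    (n : ℕ) (hn : 0 < n) (b : ℝ) (hb0 : 0 < b) (hb1 : b ≤ 1)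
    (B : ℕ → Fin n → Fin n → ℝ)
    (hB0 : ∀ k i j, 0 ≤ B k i j)
    (hBcol : ∀ k j, ∑ i, B k i j = 1)
    (hBdiag : ∀ k i, 0 < B k i i)
    (hBb : ∀ k i j, B k i j ≠ 0 → b ≤ B k i j)
    (hconn : ∀ k, ∀ i j : Fin n, i ≠ j →
      Relation.TransGen (fun p q : Fin n => p ≠ q ∧ 0 < B k p q) i j) :
    ∃ bv : ℕ → Fin n → ℝ,
      (∀ k i, 0 ≤ bv k i) ∧ (∀ k, ∑ i, bv k i = 1) ∧
      (∀ k i, bv (k+1) i = ∑ j, B k i j * bv k j) ∧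
      (∀ k i, b ^ n / (n : ℝ) ≤ bv (k+1) i) := by
  have hn' : (0 : ℝ) < n := by exact_mod_cast hn
  obtain ⟨v, hzero, hsucc⟩ : ∃ v : ℕ → Fin n → ℝ, (∀ i, v 0 i = (n : ℝ)⁻¹) ∧
      ∀ k i, v (k + 1) i = ∑ j, B k i j * v k j :=
    ⟨Nat.rec (fun _ => (n : ℝ)⁻¹) fun k w i => ∑ j, B k i j * w j,
      fun _ => rfl, fun _ _ => rfl⟩
  have hnonneg : ∀ k i, 0 ≤ v k i := by
    intro k
    induction k with
    | zero => intro i; rw [hzero]; positivity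
    | succ k ih =>
      intro i
      rw [hsucc]
      exact Finset.sum_nonneg fun j _ => mul_nonneg (hB0 k i j) (ih j)
  have hsum : ∀ k, ∑ i, v k i = 1 := by
    intro k
    induction k with
    | zero => simp [hzero, hn'.ne']
    | succ k ih =>
      simp only [hsucc]
      rw [Finset.sum_comm]
      simpa [← Finset.sum_mul, hBcol] using ih
  refine ⟨v, hnonneg, hsum, hsucc, fun k i => ?_⟩
  have hpow : ∀ t, 0 ≤ b ^ t / (n : ℝ) := fun t => by positivity
  have hmono : ∀ t ≤ n, b ^ n / (n : ℝ) ≤ b ^ t / n := fun t ht => by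
    gcongr ?_ / _
    exact pow_le_pow_of_le_one hb0.le hb1 ht
  have hstep : ∀ t, b * (b ^ t / (n : ℝ)) = b ^ (t + 1) / n := fun t => by ring
  rcases Nat.lt_or_ge (k + 1) n with hk | hk
  · have hdiag : ∀ t i, b ^ t / (n : ℝ) ≤ v t i := by
      intro t
      induction t with
      | zero => intro i; simp [hzero]
      | succ t ih =>
        intro i
        rw [← hstep, hsucc]
        exact mul_le_sum_mul (hB0 t i) (hnonneg t) (hpow t) (hBb t i i (hBdiag t i).ne') (ih i)
    exact (hmono _ hk.le).trans (hdiag (k + 1) i)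
  · obtain ⟨s, hs⟩ := Nat.exists_eq_add_of_le' (show n - 1 ≤ k + 1 by omega)
    let S : ℕ → Finset (Fin n) := fun t => Finset.univ.filter fun i => b ^ t / (n : ℝ) ≤ v (s + t) i
    have hcard : ∀ t, min (t + 1) (Fintype.card (Fin n)) ≤ (S t).card := by
      intro t
      induction t with
      | zero =>
        obtain ⟨j, -, hj⟩ : ∃ j ∈ Finset.univ, (n : ℝ)⁻¹ ≤ v s j := by
          refine Finset.exists_le_of_sum_le ⟨⟨0, hn⟩, Finset.mem_univ _⟩ ?_
          simp [hsum, hn'.ne']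
        refine (min_le_left _ _).trans (Finset.card_pos.mpr ⟨j, ?_⟩)
        simpa [S] using hj
      | succ t ih =>
        have := card_superlevel_succ (hB0 (s + t)) (hBdiag (s + t)) (hBb (s + t)) (hconn (s + t))
          (hnonneg (s + t)) (hpow t) ih
        simpa only [S, hstep, ← hsucc, ← add_assoc] using this
    have huniv : S (n - 1) = Finset.univ := by
      refine Finset.eq_univ_of_card _ (le_antisymm (Finset.card_le_univ _) ?_)
      rw [Fintype.card_fin]
      have := hcard (n - 1)
      rwa [Nat.sub_add_cancel hn, Fintype.card_fin, min_self] at this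
    have hi : b ^ (n - 1) / (n : ℝ) ≤ v (s + (n - 1)) i := by
      simpa [S] using Finset.eq_univ_iff_forall.mp huniv i
    rw [hs]
    exact (hmono _ (Nat.sub_le n 1)).trans hi
end
end
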